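/- Let ℓ ≠ p be primes, k an algebraic closure of a finite field of characteristic p, and K|k a function field with td(K|k) > 1. Let v be a Zariski prime divisor of K|k, Z_v ⊆ G^ℓ_K the decomposition group of a prolongation of v to K^ℓ, and T_v ⊆ Z_v its inertia group. Then: (a) T_v is isomorphic to ℤ_ℓ (the additive group of ℓ-adic integers) as a topological group, and the conjugation action of Z_v on T_v is trivial; (b) T_v is the unique maximal closed abelian normal subgroup of Z_v; and (c) the canonical exact sequence 1 → T_v → Z_v → G^ℓ_{Kv} → 1 splits, yielding an isomorphism of topological groups Z_v ≅ ℤ_ℓ × G^ℓ_{Kv}, where Kv is the residue field of v (a function field over k of transcendence degree td(K|k) − 1). -/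

import Mathlib

open IntermediateField

/-- Transcendence degree of a ring extension. -/
noncomputable def trdeg (k K : Type*) [CommRing k] [CommRing K] [Algebra k K] : Cardinal :=
  ⨆ s : {s : Set K // AlgebraicIndependent k ((↑) : s → K)}, Cardinal.mk s.1

/-- The maximal pro-ℓ Galois extension of `K`, inside a fixed algebraic closure: the compositum
of all finite Galois extensions of `K` of `ℓ`-power degree. -/
noncomputable def proL (ℓ : ℕ) (K : Type*) [Field K] :
    IntermediateField K (AlgebraicClosure K) :=
  ⨆ L ∈ {L : IntermediateField K (AlgebraicClosure K) |
      IsGalois K L ∧ ∃ n : ℕ, Module.finrank K L = ℓ ^ n}, L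

/-- `G^ℓ_K`, the Galois group of the maximal pro-ℓ extension of `K`,
carrying the Krull topology. -/
noncomputable abbrev GalL (ℓ : ℕ) (K : Type*) [Field K] :=
  ↥(proL ℓ K) ≃ₐ[K] ↥(proL ℓ K)

section Valuations

variable {F E : Type*} [Field F] [Field E] [Algebra F E]

private theorem aut_apply_inv_apply (a : E ≃ₐ[F] E) (x : E) : a (a⁻¹ x) = x :=
  a.apply_symm_apply x

/-- The decomposition subgroup of a valuation of `E` in the Galois group of `E|F`:
the stabilizer of the valuation ring. -/
def decompSubgroup (O : ValuationSubring E) : Subgroup (E ≃ₐ[F] E) where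
  carrier := {σ | ∀ x : E, σ x ∈ O ↔ x ∈ O}
  one_mem' := by intro x; rfl
  mul_mem' := by
    intro a b ha hb x
    simpa [AlgEquiv.mul_apply] using (ha (b x)).trans (hb x)
  inv_mem' := by
    intro a ha x
    have h := (ha (a⁻¹ x)).symm
    rwa [aut_apply_inv_apply] at h

/-- The inertia subgroup of a valuation of `E` in the Galois group of `E|F`: the elements of
the decomposition group which act trivially on the residue field. -/
def inertiaSubgroup (O : ValuationSubring E) : Subgroup (E ≃ₐ[F] E) where
  carrier := {σ | (∀ x : E, σ x ∈ O ↔ x ∈ O) ∧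
      ∀ x : E, x ∈ O → O.valuation (σ x - x) < 1}
  one_mem' := by
    refine ⟨fun x => Iff.rfl, fun x _ => ?_⟩
    simp
  mul_mem' := by
    rintro a b ⟨had, hai⟩ ⟨hbd, hbi⟩
    refine ⟨fun x => by simpa [AlgEquiv.mul_apply] using (had (b x)).trans (hbd x), ?_⟩
    intro x hx
    have h1 : O.valuation (a (b x) - b x) < 1 := hai (b x) ((hbd x).mpr hx)
    have h2 : O.valuation (b x - x) < 1 := hbi x hx
    have h3 : (a * b) x - x = (a (b x) - b x) + (b x - x) := by
      rw [AlgEquiv.mul_apply]; ring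
    rw [h3]
    exact lt_of_le_of_lt (O.valuation.map_add _ _) (max_lt h1 h2)
  inv_mem' := by
    rintro a ⟨had, hai⟩
    have hdec : ∀ x : E, a⁻¹ x ∈ O ↔ x ∈ O := by
      intro x
      have h := (had (a⁻¹ x)).symm
      rwa [aut_apply_inv_apply] at h
    refine ⟨hdec, ?_⟩
    intro x hx
    have h1 : O.valuation (a (a⁻¹ x) - a⁻¹ x) < 1 := hai _ ((hdec x).mpr hx)
    rw [aut_apply_inv_apply] at h1
    have h3 : a⁻¹ x - x = -(x - a⁻¹ x) := by ring
    rw [h3, Valuation.map_neg]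
    exact h1

end Valuations

section ZPD

variable {k K : Type*} [Field k] [Field K] [Algebra k K]

/-- The canonical map from the base field to the residue field of a valuation subring whose
ring contains the base field. -/
noncomputable def resMap (O : ValuationSubring K)
    (h : ∀ c : k, algebraMap k K c ∈ O) : k →+* IsLocalRing.ResidueField ↥O :=
  (IsLocalRing.residue ↥O).comp ((algebraMap k K).codRestrict O.toSubring h)

/-- A Zariski prime divisor of `K|k`, given by its valuation ring `O`: a nontrivial valuation
of `K`, trivial on `k`, with value group isomorphic to `ℤ`, whose residue field `Kv` satisfies
`td(Kv|k) = td(K|k) - 1`. -/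
structure IsZPD (k : Type*) [Field k] {K : Type*} [Field K] [Algebra k K]
    (O : ValuationSubring K) : Prop where
  trivialBase : ∀ c : k, algebraMap k K c ∈ O
  nontrivial : O ≠ ⊤
  discrete : Nonempty ((O.ValueGroup)ˣ ≃* Multiplicative ℤ)
  residue_td :
    letI := (resMap O trivialBase).toAlgebra
    trdeg k (IsLocalRing.ResidueField ↥O) + 1 = trdeg k K

end ZPD



theorem aut_inv_apply' {F E : Type*} [Field F] [Field E] [Algebra F E] (a : E ≃ₐ[F] E) (x : E) :
    a (a⁻¹ x) = x := a.apply_symm_apply x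

section ProL

variable (ℓ : ℕ) [Fact ℓ.Prime] (K : Type*) [Field K]

theorem pow_fix_mono {K Ω : Type*} [Field K] [Field Ω] [Algebra K Ω] {ℓ n m : ℕ} (h : n ≤ m)
    (σ : Ω ≃ₐ[K] Ω) (x : Ω) (hx : (σ ^ (ℓ ^ n)) x = x) : (σ ^ (ℓ ^ m)) x = x := by
  have h2 : σ ^ (ℓ ^ n) ∈ MulAction.stabilizer (Ω ≃ₐ[K] Ω) x := hx
  obtain ⟨d, rfl⟩ := Nat.exists_eq_add_of_le h
  have h3 := Subgroup.pow_mem _ h2 (ℓ ^ d)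
  rw [← pow_mul, ← pow_add] at h3
  exact h3

/-- auxiliary description of `proL` -/
noncomputable def proLAux : IntermediateField K (AlgebraicClosure K) where
  carrier := {x | x ∈ separableClosure K (AlgebraicClosure K) ∧
    ∃ n : ℕ, ∀ σ : AlgebraicClosure K ≃ₐ[K] AlgebraicClosure K, (σ ^ (ℓ ^ n)) x = x}
  mul_mem' := by
    rintro a b ⟨ha, n, hn⟩ ⟨hb, m, hm⟩
    refine ⟨mul_mem ha hb, max n m, fun σ => ?_⟩
    rw [map_mul, pow_fix_mono (le_max_left n m) σ a (hn σ),
      pow_fix_mono (le_max_right n m) σ b (hm σ)]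
  add_mem' := by
    rintro a b ⟨ha, n, hn⟩ ⟨hb, m, hm⟩
    refine ⟨add_mem ha hb, max n m, fun σ => ?_⟩
    rw [map_add, pow_fix_mono (le_max_left n m) σ a (hn σ),
      pow_fix_mono (le_max_right n m) σ b (hm σ)]
  algebraMap_mem' := fun r => ⟨_root_.algebraMap_mem _ r, 0, fun σ => AlgEquiv.commutes _ r⟩
  inv_mem' := by
    rintro a ⟨ha, n, hn⟩
    exact ⟨inv_mem ha, n, fun σ => by rw [map_inv₀, hn]⟩

theorem proL_eq : proL ℓ K = proLAux ℓ K := by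
  apply le_antisymm
  · refine iSup₂_le ?_
    rintro L ⟨hG, n, hn⟩ x hx
    have : FiniteDimensional K L := by
      apply FiniteDimensional.of_finrank_pos
      rw [hn]; exact pow_pos (Fact.out : ℓ.Prime).pos _
    refine ⟨le_separableClosure K _ L hx, n, fun σ => ?_⟩
    have h1 : (AlgEquiv.restrictNormalHom L σ) ^ (ℓ ^ n) = 1 := by
      rw [← hn, ← IsGalois.card_aut_eq_finrank]
      exact pow_card_eq_one'
    rw [← map_pow] at h1
    have h2 := AlgEquiv.restrictNormal_commutes (σ ^ (ℓ ^ n)) L ⟨x, hx⟩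
    have h3 : (AlgEquiv.restrictNormal (σ ^ (ℓ ^ n)) L) ⟨x, hx⟩ = ⟨x, hx⟩ := by
      change (AlgEquiv.restrictNormalHom L (σ ^ (ℓ ^ n))) ⟨x, hx⟩ = _
      rw [h1]; rfl
    rw [h3] at h2
    exact h2.symm
  · rintro x ⟨hx, n, hn⟩
    let N := normalClosure K K⟮x⟯ (AlgebraicClosure K)
    have hxN : x ∈ N := (le_normalClosure K⟮x⟯) (mem_adjoin_simple_self K x)
    have hint : IsIntegral K x := Algebra.IsIntegral.isIntegral x
    have : FiniteDimensional K K⟮x⟯ := adjoin.finiteDimensional hint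
    have : FiniteDimensional K N := inferInstance
    have hNs : N ≤ separableClosure K (AlgebraicClosure K) := by
      have h1 : K⟮x⟯ ≤ separableClosure K (AlgebraicClosure K) := by
        rw [adjoin_simple_le_iff]; exact hx
      rw [← separableClosure.normalClosure_eq_self]
      exact normalClosure_mono _ _ h1
    have : Algebra.IsSeparable K N := (le_separableClosure_iff K _ N).mp hNs
    have : IsGalois K N := {}
    have key : ∀ g : N ≃ₐ[K] N, g ^ (ℓ ^ n) = 1 := by
      intro g
      obtain ⟨σ, rfl⟩ := AlgEquiv.restrictNormalHom_surjective (AlgebraicClosure K) g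
      rw [← map_pow]
      have hfix : N ≤ fixedField (Subgroup.zpowers (σ ^ (ℓ ^ n))) := by
        change normalClosure K K⟮x⟯ (AlgebraicClosure K) ≤ _
        rw [normalClosure_def'']
        refine iSup_le fun f => ?_
        rw [adjoin_map, adjoin_le_iff, Set.image_singleton, Set.singleton_subset_iff]
        change _ ∈ fixedField _
        rw [mem_fixedField_iff]
        rintro _ ⟨i, rfl⟩
        have h1 : (σ ^ (ℓ ^ n)) (f x) = f x := by
          have h2 := hn (f⁻¹ * σ * f)
          have h3 : (f⁻¹ * σ * f) ^ (ℓ ^ n) = f⁻¹ * σ ^ (ℓ ^ n) * f := by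
            have := conj_pow (a := f⁻¹) (b := σ) (i := ℓ ^ n)
            rwa [inv_inv] at this
          rw [h3] at h2
          have h4 := congrArg f h2
          simpa [AlgEquiv.mul_apply, aut_inv_apply'] using h4
        have h2 : σ ^ (ℓ ^ n) ∈ MulAction.stabilizer (AlgebraicClosure K ≃ₐ[K] AlgebraicClosure K) (f x) := h1
        exact Subgroup.zpow_mem _ h2 i
      ext y
      have h2 := AlgEquiv.restrictNormal_commutes (σ ^ (ℓ ^ n)) N y
      change algebraMap N (AlgebraicClosure K) (AlgEquiv.restrictNormal (σ ^ (ℓ ^ n)) N y) = y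
      rw [h2]
      exact (mem_fixedField_iff _ _).mp (hfix y.2) _ (Subgroup.mem_zpowers _)
    have hP : IsPGroup ℓ (N ≃ₐ[K] N) := fun g => ⟨n, key g⟩
    obtain ⟨m, hm⟩ := IsPGroup.iff_card.mp hP
    rw [IsGalois.card_aut_eq_finrank] at hm
    have : N ≤ proL ℓ K := le_iSup₂_of_le (f := fun L (_ : L ∈ {L : IntermediateField K (AlgebraicClosure K) |
      IsGalois K L ∧ ∃ n : ℕ, Module.finrank K L = ℓ ^ n}) => L) N ⟨inferInstance, m, hm⟩ le_rfl
    exact this hxN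

theorem proL_isGalois : IsGalois K (proL ℓ K) := by
  have h1 : Algebra.IsSeparable K (proL ℓ K) := by
    rw [proL_eq]
    exact (le_separableClosure_iff K _ _).mp fun x hx => hx.1
  have h2 : Normal K (proL ℓ K) := by
    have h3 : proL ℓ K = ⨆ L : {L : IntermediateField K (AlgebraicClosure K) //
        IsGalois K L ∧ ∃ n : ℕ, Module.finrank K L = ℓ ^ n}, L.1 := by
      unfold proL
      rw [iSup_subtype]
      rfl
    rw [h3]
    have : ∀ L : {L : IntermediateField K (AlgebraicClosure K) //
        IsGalois K L ∧ ∃ n : ℕ, Module.finrank K L = ℓ ^ n}, Normal K L.1 := fun L =>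
      have := L.2.1
      inferInstance
    exact IntermediateField.normal_iSup _ _ _
  exact {}

variable {ℓ K}

theorem proL_root (hℓ : (ℓ : K) ≠ 0) {ζ : K} (hζ : IsPrimitiveRoot ζ ℓ) {x : AlgebraicClosure K}
    (hx : x ^ ℓ ∈ proL ℓ K) : x ∈ proL ℓ K := by
  have hp : ℓ.Prime := Fact.out
  rw [proL_eq] at hx ⊢
  obtain ⟨hs, n, hn⟩ := hx
  by_cases hx0 : x = 0
  · rw [hx0]; exact zero_mem _
  refine ⟨?_, n + 1, fun σ => ?_⟩
  · let S := separableClosure K (AlgebraicClosure K)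
    have h1 : IsSeparable S x := by
      let f : Polynomial S := Polynomial.X ^ ℓ - Polynomial.C ⟨x ^ ℓ, hs⟩
      have hf : f.Separable := by
        apply Polynomial.separable_X_pow_sub_C
        · intro h
          apply hℓ
          have : algebraMap K S (ℓ : K) = 0 := by rw [map_natCast]; exact h
          exact (map_eq_zero _).mp this
        · intro h
          exact pow_ne_zero ℓ hx0 (congrArg Subtype.val h)
      refine Polynomial.Separable.of_dvd hf (minpoly.dvd _ _ ?_)
      simp [f]
    have h2 : x ∈ separableClosure S (AlgebraicClosure K) := mem_separableClosure_iff.mpr h1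
    rw [separableClosure.separableClosure_eq_bot] at h2
    obtain ⟨y, hy⟩ := IntermediateField.mem_bot.mp h2
    rw [← hy]; exact y.2
  · have h1 := hn σ
    rw [map_pow] at h1
    set τ := σ ^ (ℓ ^ n) with hτ
    have hζ' := hζ.map_of_injective (algebraMap K (AlgebraicClosure K)).injective
    obtain ⟨i, -, hi⟩ := hζ'.eq_pow_of_pow_eq_one (ξ := τ x / x) (by
      rw [div_pow, h1, div_self (pow_ne_zero _ hx0)])
    have h2 : τ x = algebraMap K _ (ζ ^ i) * x := by
      rw [map_pow, hi, div_mul_cancel₀ _ hx0]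
    have h3 : ∀ m : ℕ, (τ ^ m) x = algebraMap K _ (ζ ^ i) ^ m * x := by
      intro m
      induction m with
      | zero => simp
      | succ m ih =>
        rw [pow_succ', AlgEquiv.mul_apply, ih, map_mul, map_pow, AlgEquiv.commutes, h2]; ring
    rw [pow_succ, pow_mul, ← hτ, h3, ← map_pow, ← pow_mul, mul_comm i, pow_mul, hζ.pow_eq_one]
    simp

/-- `proL` is contained in every subextension closed under `ℓ`-th roots. -/
theorem proL_le (hℓ : (ℓ : K) ≠ 0) {ζ : K} (hζ : IsPrimitiveRoot ζ ℓ)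
    (S : IntermediateField K (AlgebraicClosure K))
    (hS : ∀ x, x ^ ℓ ∈ S → x ∈ S) : proL ℓ K ≤ S := by
  have hp : ℓ.Prime := Fact.out
  refine iSup₂_le ?_
  rintro L ⟨hG, n, hn⟩
  have : FiniteDimensional K L := by
    apply FiniteDimensional.of_finrank_pos
    rw [hn]; exact pow_pos hp.pos _
  have hcard : Nat.card (L ≃ₐ[K] L) = ℓ ^ n := by rw [← hn, IsGalois.card_aut_eq_finrank]
  have key : ∀ m ≤ n, ∀ H : Subgroup (L ≃ₐ[K] L), Nat.card H = ℓ ^ (n - m) →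
      ∀ a : L, (∀ h ∈ H, h a = a) → (a : AlgebraicClosure K) ∈ S := by
    intro m
    induction m with
    | zero =>
      intro _ H hH a ha
      have : H = ⊤ := by
        apply Subgroup.eq_top_of_card_eq
        rw [hH, hcard, Nat.sub_zero]
      have h1 : a ∈ (⊥ : IntermediateField K L) :=
        (IsGalois.mem_bot_iff_fixed a).mpr fun f => ha f (this ▸ Subgroup.mem_top f)
      obtain ⟨c, rfl⟩ := IntermediateField.mem_bot.mp h1
      exact _root_.algebraMap_mem S c
    | succ m ih =>
      intro hm H hH a ha
      have hmn : n - m = n - (m + 1) + 1 := by omega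
      obtain ⟨H', hH', hle⟩ := Sylow.exists_subgroup_card_pow_succ (G := L ≃ₐ[K] L) (p := ℓ)
        (n := n - (m+1)) (by rw [hcard]; exact pow_dvd_pow _ (by omega)) hH
      have hidx : H.relIndex H' = ℓ := by
        have h1 := Subgroup.card_mul_index (H.subgroupOf H')
        rw [Nat.card_congr (Subgroup.subgroupOfEquivOfLe hle).toEquiv, hH, hH', pow_succ] at h1
        exact Nat.eq_of_mul_eq_mul_left (pow_pos hp.pos _) h1
      have hnorm : (H.subgroupOf H').Normal := by
        apply Subgroup.normal_of_index_eq_minFac_card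
        change H.relIndex H' = _
        rw [hidx, hH', Nat.pow_minFac (by omega), hp.minFac_eq]
      have hlt : ∃ s ∈ H', s ∉ H := by
        by_contra hcon
        push Not at hcon
        have : H' = H := le_antisymm hcon hle
        rw [this, hH] at hH'
        have := Nat.pow_right_injective hp.two_le hH'
        omega
      obtain ⟨s, hs', hs⟩ := hlt
      have hsp : s ^ ℓ ∈ H := by
        have := Subgroup.pow_index_mem (H.subgroupOf H') ⟨s, hs'⟩
        change (⟨s, hs'⟩ : H') ^ (H.relIndex H') ∈ _ at this
        rw [hidx] at this
        exact this
      have hconj : ∀ t ∈ H', ∀ h ∈ H, t⁻¹ * h * t ∈ H := by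
        intro t ht h hh
        have := hnorm.conj_mem ⟨h, hle hh⟩ hh (⟨t, ht⟩⁻¹)
        simpa [Subgroup.mem_subgroupOf] using this
      -- the group generated by H and s is H'
      have hgen : ∀ b : L, (∀ h ∈ H, h b = b) → s b = b → ∀ h ∈ H', h b = b := by
        intro b hb hsb
        let St : Subgroup (L ≃ₐ[K] L) := MulAction.stabilizer (L ≃ₐ[K] L) b ⊓ H'
        have h1 : H ≤ St := le_inf hb hle
        have h2 : St = H' := by
          have hd1 : Nat.card H ∣ Nat.card St := Subgroup.card_dvd_of_le h1
          have hd2 : Nat.card St ∣ Nat.card H' := Subgroup.card_dvd_of_le inf_le_right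
          rw [hH'] at hd2
          obtain ⟨j, hj, hj'⟩ := (Nat.dvd_prime_pow hp).mp hd2
          have hne : j ≠ n - (m+1) := by
            intro he
            have : H = St := Subgroup.eq_of_le_of_card_ge h1 (by rw [hj', hH, he])
            apply hs
            rw [this]
            exact ⟨hsb, hs'⟩
          rw [hH, hj'] at hd1
          have := (Nat.pow_dvd_pow_iff_le_right hp.one_lt).mp hd1
          have : j = n - (m+1) + 1 := by omega
          exact Subgroup.eq_of_le_of_card_ge inf_le_right (by rw [hj', hH', this])
        intro h hh
        rw [← h2] at hh
        exact hh.1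
      have hpowfix : ∀ i : ℕ, ∀ h ∈ H, h ((s ^ i) a) = (s ^ i) a := by
        intro i h hh
        have := ha _ (hconj (s ^ i) (pow_mem hs' i) h hh)
        have h3 := congrArg (s ^ i) this
        simpa [AlgEquiv.mul_apply, aut_inv_apply'] using h3
      let y : ℕ → L := fun j => ∑ i ∈ Finset.range ℓ, algebraMap K L (ζ ^ j) ^ i * (s ^ i) a
      have hsy : ∀ j, algebraMap K L (ζ ^ j) * s (y j) = y j := by
        intro j
        simp only [y, map_sum, Finset.mul_sum]
        have h1 : ∀ i, algebraMap K L (ζ ^ j) * s (algebraMap K L (ζ ^ j) ^ i * (s ^ i) a)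
          = algebraMap K L (ζ ^ j) ^ (i+1) * (s ^ (i+1)) a := by
          intro i
          rw [map_mul, map_pow s, AlgEquiv.commutes, pow_succ' s, AlgEquiv.mul_apply]; ring
        simp only [h1]
        have h2 := Finset.sum_range_succ' (fun i => algebraMap K L (ζ ^ j) ^ i * (s ^ i) a) ℓ
        rw [Finset.sum_range_succ] at h2
        have h3 : algebraMap K L (ζ ^ j) ^ ℓ * (s ^ ℓ) a = algebraMap K L (ζ ^ j) ^ 0 * (s ^ 0) a := by
          rw [← map_pow, ← pow_mul, mul_comm j, pow_mul, hζ.pow_eq_one, ha _ hsp]; simp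
        rw [h3] at h2
        exact (add_right_cancel h2).symm
      have hyH : ∀ j, ∀ h ∈ H, h (y j) = y j := by
        intro j h hh
        simp only [y, map_sum]
        refine Finset.sum_congr rfl fun i _ => ?_
        rw [map_mul, hpowfix i h hh, map_pow, AlgEquiv.commutes]
      have hyS : ∀ j, ((y j : L) : AlgebraicClosure K) ∈ S := by
        intro j
        apply hS
        have h1 : ∀ h ∈ H', h (y j ^ ℓ) = y j ^ ℓ := by
          apply hgen
          · intro h hh; rw [map_pow, hyH j h hh]
          · rw [map_pow]
            conv_rhs => rw [← hsy j]
            rw [mul_pow, ← map_pow (algebraMap K L), ← pow_mul, mul_comm j, pow_mul, hζ.pow_eq_one]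
            simp
        have h2 := ih (by omega) H' (by rw [hH', hmn]) _ h1
        simpa using h2
      have hsum : ∑ j ∈ Finset.range ℓ, y j = (ℓ : L) * a := by
        simp only [y]
        rw [Finset.sum_comm]
        rw [Finset.sum_eq_single_of_mem 0 (Finset.mem_range.mpr hp.pos)]
        · simp
        · intro i hi hi0
          rw [← Finset.sum_mul]
          have : ∑ j ∈ Finset.range ℓ, algebraMap K L (ζ ^ j) ^ i = 0 := by
            have h1 : IsPrimitiveRoot (ζ ^ i) ℓ := hζ.pow_of_coprime i
              (((Nat.coprime_primes hp hp).not.mpr (by simp)) |> fun _ =>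
                (Nat.Coprime.symm ((Nat.Prime.coprime_iff_not_dvd hp).mpr
                  (Nat.not_dvd_of_pos_of_lt (Nat.pos_of_ne_zero hi0) (Finset.mem_range.mp hi)))))
            have h2 := h1.geom_sum_eq_zero hp.one_lt
            have h3 := congrArg (algebraMap K L) h2
            rw [map_zero, map_sum] at h3
            rw [← h3]
            refine Finset.sum_congr rfl fun j _ => ?_
            rw [← map_pow, ← pow_mul, ← pow_mul, mul_comm]
          rw [this, zero_mul]
      have hsumS : ((ℓ : L) * a : L) ∈ S.comap L.val := by
        rw [← hsum]
        exact sum_mem fun j _ => hyS j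
      have hl : (ℓ : L) ≠ 0 := by
        intro h
        apply hℓ
        rw [← map_natCast (algebraMap K L)] at h
        exact (map_eq_zero _).mp h
      have hlS : (ℓ : L) ∈ S.comap L.val := _root_.natCast_mem _ _
      have h5 := mul_mem (inv_mem hlS) hsumS
      rw [inv_mul_cancel_left₀ hl] at h5
      exact h5
  intro x hx
  have := key n le_rfl ⊥ (by simp) ⟨x, hx⟩ (by rintro h hh; rw [Subgroup.mem_bot.mp hh]; rfl)
  exact this

end ProL


section ValTheory

variable {F E : Type*} [Field F] [Field E] [Algebra F E]

theorem isIntegral_of_all_val (R : Subring F) (x : E)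
    (h : ∀ W : ValuationSubring E, (∀ r ∈ R, algebraMap F E r ∈ W) → x ∈ W) :
    IsIntegral R x := by
  by_contra hx
  have hx' : x ∉ (integralClosure R E).toSubring := fun h => hx h
  obtain ⟨V, hV, hxV⟩ := Subring.exists_le_valuationSubring_of_isIntegrallyClosedIn hx'
  refine hxV (h V fun r hr => hV ?_)
  have : (algebraMap F E r) = algebraMap R E ⟨r, hr⟩ := rfl
  rw [this]
  exact (integralClosure R E).algebraMap_mem _

theorem mem_val_of_isIntegral (O : ValuationSubring E) (x : E)
    (h : IsIntegral (O.comap (algebraMap F E)) x) : x ∈ O := by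
  have : IsIntegral O x := by
    obtain ⟨p, hp, hpx⟩ := h
    let f : (O.comap (algebraMap F E)) →+* O :=
      ((algebraMap F E).comp (O.comap (algebraMap F E)).subtype).codRestrict O.toSubring
        (fun x => x.2)
    refine ⟨p.map f, hp.map f, ?_⟩
    rw [Polynomial.eval₂_map]
    exact hpx
  obtain ⟨y, hy⟩ := IsIntegrallyClosed.isIntegral_iff.mp this
  rw [← hy]; exact y.2

theorem pow_mul_inv_pow {x : E} (hx : x ≠ 0) (j d : ℕ) :
    x ^ j * x⁻¹ ^ (j + d) = x⁻¹ ^ d := by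
  rw [pow_add, ← mul_assoc, ← mul_pow, mul_inv_cancel₀ hx, one_pow, one_mul]

/-- key normalization lemma -/
theorem exists_integral_fraction [Algebra.IsAlgebraic F E] (O : ValuationSubring E) (x : E)
    (hx : x ∈ O) : ∃ s t : E, IsIntegral (O.comap (algebraMap F E)) s ∧
      IsIntegral (O.comap (algebraMap F E)) t ∧ O.valuation (s - 1) < 1 ∧ s * x = t := by
  obtain ⟨p, hp0, hpx⟩ := Algebra.IsAlgebraic.isAlgebraic (R := F) x
  set v := O.valuation
  let w : ℕ → O.ValueGroup := fun j => v (algebraMap F E (p.coeff j))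
  obtain ⟨i₀, hi₀s, hi₀⟩ := p.support.exists_max_image w (Polynomial.nonempty_support_iff.mpr hp0)
  obtain ⟨i, hi, himax⟩ := (p.support.filter (fun j => w j = w i₀)).exists_max_image id
    ⟨i₀, by simp [hi₀s, -Polynomial.mem_support_iff]⟩
  rw [Finset.mem_filter] at hi
  have hpi : p.coeff i ≠ 0 := Polynomial.mem_support_iff.mp hi.1
  have hle : ∀ j, w j ≤ w i := by
    intro j
    by_cases hj : j ∈ p.support
    · rw [hi.2]; exact hi₀ j hj
    · have : w j = 0 := by simp [w, Polynomial.notMem_support_iff.mp hj]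
      rw [this]; exact zero_le
  have hlt : ∀ j, i < j → w j < w i := by
    intro j hij
    refine lt_of_le_of_ne (hle j) fun heq => ?_
    by_cases hj : j ∈ p.support
    · have := himax j (Finset.mem_filter.mpr ⟨hj, heq.trans hi.2⟩)
      simp at this; omega
    · have : w j = 0 := by simp [w, Polynomial.notMem_support_iff.mp hj]
      rw [this] at heq
      have : w i ≠ 0 := by simp [w, v, hpi]
      exact this heq.symm
  have hwi : 0 < w i := by
    rw [zero_lt_iff]; simp [w, v, hpi]
  let q : ℕ → F := fun j => p.coeff j / p.coeff i
  have hq : ∀ j, v (algebraMap F E (q j)) ≤ 1 := by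
    intro j
    simp only [q, map_div₀]
    exact (div_le_one₀ hwi).mpr (hle j)
  have hq' : ∀ j, i < j → v (algebraMap F E (q j)) < 1 := by
    intro j hj
    simp only [q, map_div₀]
    exact (div_lt_one₀ hwi).mpr (hlt j hj)
  have hqi : q i = 1 := div_self hpi
  let n := p.natDegree
  have hin : i ≤ n := Polynomial.le_natDegree_of_mem_supp i hi.1
  have hsum : ∑ j ∈ Finset.range (n+1), algebraMap F E (q j) * x ^ j = 0 := by
    have := hpx
    rw [Polynomial.aeval_eq_sum_range] at this
    have h2 : ∑ j ∈ Finset.range (n+1), algebraMap F E (q j) * x ^ j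
      = (algebraMap F E (p.coeff i))⁻¹ * ∑ j ∈ Finset.range (n+1), p.coeff j • x ^ j := by
      rw [Finset.mul_sum]
      refine Finset.sum_congr rfl fun j _ => ?_
      simp only [q, map_div₀, Algebra.smul_def]; ring
    rw [h2, this, mul_zero]
  obtain ⟨m, hm⟩ : ∃ m, n + 1 = i + (m + 1) := ⟨n - i, by omega⟩
  let s : E := ∑ j ∈ Finset.range (m+1), algebraMap F E (q (i+j)) * x ^ j
  have hs : s * x ^ i = - ∑ j ∈ Finset.range i, algebraMap F E (q j) * x ^ j := by
    rw [hm, Finset.sum_range_add] at hsum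
    rw [eq_neg_iff_add_eq_zero, add_comm, ← hsum]
    congr 1
    rw [Finset.sum_mul]
    refine Finset.sum_congr rfl fun j _ => ?_
    ring
  have hv : ∀ j, q j ∈ O.comap (algebraMap F E) := fun j => by
    rw [ValuationSubring.mem_comap, ← O.valuation_le_one_iff]; exact hq j
  refine ⟨s, s * x, ?_, ?_, ?_, rfl⟩
  · refine isIntegral_of_all_val (O.comap (algebraMap F E)).toSubring _ fun W hW => ?_
    have hW' : ∀ j, algebraMap F E (q j) ∈ W := fun j => hW _ (hv j)
    by_cases hxW : x ∈ W
    · exact sum_mem fun j _ => mul_mem (hW' _) (pow_mem hxW _)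
    · have hx0 : x ≠ 0 := by rintro rfl; exact hxW W.zero_mem
      have hxi : x⁻¹ ∈ W := (W.mem_or_inv_mem x).resolve_left hxW
      have : s = - ∑ j ∈ Finset.range i, algebraMap F E (q j) * x⁻¹ ^ (i - j) := by
        have : s = (s * x^i) * x⁻¹ ^ i := by
          rw [mul_assoc, ← mul_pow, mul_inv_cancel₀ hx0, one_pow, mul_one]
        rw [this, hs, neg_mul, Finset.sum_mul]
        congr 1
        refine Finset.sum_congr rfl fun j hj => ?_
        have hj : j < i := Finset.mem_range.mp hj
        obtain ⟨d, rfl⟩ := Nat.exists_eq_add_of_lt hj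
        rw [show j + d + 1 - j = d + 1 by omega, mul_assoc, add_assoc j, pow_mul_inv_pow hx0]
      rw [this]
      exact neg_mem (sum_mem fun j _ => mul_mem (hW' _) (pow_mem hxi _))
  · refine isIntegral_of_all_val (O.comap (algebraMap F E)).toSubring _ fun W hW => ?_
    have hW' : ∀ j, algebraMap F E (q j) ∈ W := fun j => hW _ (hv j)
    by_cases hxW : x ∈ W
    · exact mul_mem (sum_mem fun j _ => mul_mem (hW' _) (pow_mem hxW _)) hxW
    · have hx0 : x ≠ 0 := by rintro rfl; exact hxW W.zero_mem
      have hxi : x⁻¹ ∈ W := (W.mem_or_inv_mem x).resolve_left hxW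
      have : s * x = - ∑ j ∈ Finset.range i, algebraMap F E (q j) * x⁻¹ ^ (i - 1 - j) := by
        have : s * x = (s * x^i) * x⁻¹ ^ i * x := by
          rw [mul_assoc s, ← mul_pow, mul_inv_cancel₀ hx0, one_pow, mul_one]
        rw [this, hs, neg_mul, neg_mul, Finset.sum_mul, Finset.sum_mul]
        congr 1
        refine Finset.sum_congr rfl fun j hj => ?_
        have hj : j < i := Finset.mem_range.mp hj
        obtain ⟨d, rfl⟩ := Nat.exists_eq_add_of_lt hj
        rw [show j + d + 1 - 1 - j = d by omega, mul_assoc (algebraMap F E _), add_assoc j, pow_mul_inv_pow hx0,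
          pow_succ, mul_assoc, mul_assoc, inv_mul_cancel₀ hx0, mul_one]
      rw [this]
      exact neg_mem (sum_mem fun j _ => mul_mem (hW' _) (pow_mem hxi _))
  · have : s - 1 = ∑ j ∈ Finset.range m, algebraMap F E (q (i+(j+1))) * x ^ (j+1) := by
      simp only [s]
      rw [Finset.sum_range_succ']
      simp [hqi]
    rw [this]
    refine Valuation.map_sum_lt _ one_ne_zero fun j _ => ?_
    rw [map_mul, map_pow]
    have h1 : v x ^ (j+1) ≤ 1 := pow_le_one₀ zero_le ((O.valuation_le_one_iff x).mpr hx)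
    exact mul_lt_one_of_lt_of_le (hq' _ (by omega)) h1

/-- rational rank -/
theorem exists_pow_val [Algebra.IsAlgebraic F E] (O : ValuationSubring E) (x : E)
    (hx : x ≠ 0) : ∃ m : ℕ, 0 < m ∧ ∃ a : F, a ≠ 0 ∧
      O.valuation x ^ m = O.valuation (algebraMap F E a) := by
  obtain ⟨p, hp0, hpx⟩ := Algebra.IsAlgebraic.isAlgebraic (R := F) x
  set v := O.valuation
  have hvx : v x ≠ 0 := (Valuation.ne_zero_iff _).mpr hx
  let w : ℕ → O.ValueGroup := fun j => v (algebraMap F E (p.coeff j) * x ^ j)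
  obtain ⟨i, his, hi⟩ := p.support.exists_max_image w (Polynomial.nonempty_support_iff.mpr hp0)
  have key : ∃ j ∈ p.support, j ≠ i ∧ w j = w i := by
    by_contra hcon
    push Not at hcon
    have h1 : v (∑ j ∈ p.support, algebraMap F E (p.coeff j) * x ^ j) = w i :=
      Valuation.map_sum_eq_of_lt v (f := fun j => algebraMap F E (p.coeff j) * x ^ j) his
        fun j hj => lt_of_le_of_ne (hi j (Finset.mem_sdiff.mp hj).1)
         (hcon j (Finset.mem_sdiff.mp hj).1 (by simpa using (Finset.mem_sdiff.mp hj).2))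
    have h2 : (∑ j ∈ p.support, algebraMap F E (p.coeff j) * x ^ j) = 0 := by
      rw [← hpx, Polynomial.aeval_def, Polynomial.eval₂_eq_sum]; rfl
    rw [h2, map_zero] at h1
    have := (Valuation.zero_iff v).mp h1.symm
    simp [hx] at this
    exact (Polynomial.mem_support_iff.mp his) this
  obtain ⟨j, hj, hji, hw⟩ := key
  have aux : ∀ i j : ℕ, i < j → p.coeff i ≠ 0 → p.coeff j ≠ 0 → w j = w i →
    ∃ m : ℕ, 0 < m ∧ ∃ a : F, a ≠ 0 ∧ v x ^ m = v (algebraMap F E a) := by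
    intro i j hij hci hcj hw
    refine ⟨j - i, by omega, p.coeff i / p.coeff j, div_ne_zero hci hcj, ?_⟩
    obtain ⟨d, rfl⟩ := Nat.exists_eq_add_of_lt hij
    have hcj' : v (algebraMap F E (p.coeff (i+d+1))) ≠ 0 := by simp [v, hcj]
    simp only [w, map_mul, map_pow] at hw
    rw [show i + d + 1 - i = d + 1 by omega, map_div₀, map_div₀, eq_div_iff hcj']
    have hxi : v x ^ i ≠ 0 := pow_ne_zero _ hvx
    apply mul_right_cancel₀ hxi
    rw [← hw, mul_right_comm, ← pow_add, mul_comm, show d + 1 + i = i + d + 1 by ring]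
  rcases lt_or_gt_of_ne hji with h | h
  · exact aux j i h (Polynomial.mem_support_iff.mp hj) (Polynomial.mem_support_iff.mp his) hw.symm
  · exact aux i j h (Polynomial.mem_support_iff.mp his) (Polynomial.mem_support_iff.mp hj) hw

end ValTheory


section ValTheory2

variable {F E : Type*} [Field F] [Field E] [Algebra F E]

theorem val_lt_one_iff' (O : ValuationSubring E) (x : E) :
    O.valuation x < 1 ↔ x = 0 ∨ x⁻¹ ∉ O := by
  by_cases hx : x = 0
  · simp [hx]
  · simp only [hx, false_or]
    rw [← O.valuation_le_one_iff, map_inv₀, not_le, one_lt_inv₀]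
    exact zero_lt_iff.mpr ((Valuation.ne_zero_iff _).mpr hx)

theorem residue_eq_iff (O : ValuationSubring E) (x y : O) :
    IsLocalRing.residue O x = IsLocalRing.residue O y ↔ O.valuation ((x:E) - y) < 1 := by
  rw [← sub_eq_zero, ← map_sub, IsLocalRing.residue_eq_zero_iff, ValuationSubring.valuation_lt_one_iff]
  rfl

/-- the inclusion of the integral closure -/
noncomputable def toO (R : ValuationSubring F) (O : ValuationSubring E)
    (h : O.comap (algebraMap F E) = R) : integralClosure R E →+* O :=
  ((integralClosure R E).toSubring.subtype).codRestrict O.toSubring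
    (fun x => by subst h; exact mem_val_of_isIntegral O x.1 x.2)

@[simp] theorem toO_coe (R : ValuationSubring F) (O : ValuationSubring E)
    (h : O.comap (algebraMap F E) = R) (b : integralClosure R E) : ((toO R O h b : O) : E) = b := rfl

/-- the prime of the integral closure below `O` -/
noncomputable def Qid (R : ValuationSubring F) (O : ValuationSubring E)
    (h : O.comap (algebraMap F E) = R) : Ideal (integralClosure R E) :=
  (IsLocalRing.maximalIdeal O).comap (toO R O h)

theorem mem_Qid {R : ValuationSubring F} {O : ValuationSubring E}
    (h : O.comap (algebraMap F E) = R) (b : integralClosure R E) :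
    b ∈ Qid R O h ↔ O.valuation (b : E) < 1 := by
  rw [Qid, Ideal.mem_comap, ValuationSubring.valuation_lt_one_iff]; rfl

instance (R : ValuationSubring F) (O : ValuationSubring E)
    (h : O.comap (algebraMap F E) = R) : (Qid R O h).IsPrime := by
  unfold Qid; infer_instance

theorem val_int {R : ValuationSubring F} {O : ValuationSubring E}
    (h : O.comap (algebraMap F E) = R) (b : integralClosure R E) : O.valuation (b : E) ≤ 1 :=
  (O.valuation_le_one_iff _).mpr (toO R O h b).2

theorem exists_frac [Algebra.IsAlgebraic F E] {R : ValuationSubring F} {O : ValuationSubring E}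
    (h : O.comap (algebraMap F E) = R) (x : E) (hx : x ∈ O) : ∃ s t : integralClosure R E,
      O.valuation ((s:E) - 1) < 1 ∧ O.valuation (s:E) = 1 ∧ (s:E) * x = t := by
  subst h
  obtain ⟨s, t, hs, ht, h1, h2⟩ := exists_integral_fraction (F := F) O x hx
  refine ⟨⟨s, hs⟩, ⟨t, ht⟩, h1, ?_, h2⟩
  have : O.valuation (s - 1 + 1) = O.valuation 1 := Valuation.map_add_eq_of_lt_right O.valuation (x := s - 1) (y := 1)
    (by rw [Valuation.map_one]; exact h1)
  simpa using this

theorem mem_of_frac {R : ValuationSubring F} {O : ValuationSubring E}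
    (h : O.comap (algebraMap F E) = R) (x : E) (s t : integralClosure R E)
    (hs : s ∉ Qid R O h) (hx : (s : E) * x = t) : x ∈ O := by
  rw [mem_Qid, not_lt] at hs
  have hs1 := le_antisymm (val_int h s) hs
  rw [← O.valuation_le_one_iff]
  have := val_int h t
  rwa [← hx, map_mul, hs1, one_mul] at this

theorem dec_of [Algebra.IsAlgebraic F E] {R : ValuationSubring F} {O₁ O₂ : ValuationSubring E}
    (h₁ : O₁.comap (algebraMap F E) = R) (h₂ : O₂.comap (algebraMap F E) = R) (g : E ≃ₐ[F] E)
    (hg : ∀ b : integralClosure R E, g • b ∈ Qid R O₂ h₂ ↔ b ∈ Qid R O₁ h₁) (x : E) :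
    g x ∈ O₂ ↔ x ∈ O₁ := by
  have key : ∀ {O₁ O₂ : ValuationSubring E}
    (h₁ : O₁.comap (algebraMap F E) = R) (h₂ : O₂.comap (algebraMap F E) = R) (g : E ≃ₐ[F] E)
    (_hg : ∀ b : integralClosure R E, g • b ∈ Qid R O₂ h₂ ↔ b ∈ Qid R O₁ h₁) (x : E),
     x ∈ O₁ → g x ∈ O₂ := by
    intro O₁ O₂ h₁ h₂ g hg x hx
    obtain ⟨s, t, -, hs, hst⟩ := exists_frac h₁ x hx
    refine mem_of_frac h₂ (g x) (g • s) (g • t) ?_ ?_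
    · rw [hg, mem_Qid, hs]; exact lt_irrefl _
    · rw [integralClosure.coe_smul, integralClosure.coe_smul, ← hst]
      simp
  refine ⟨fun hx => ?_, key h₁ h₂ g hg x⟩
  have := key h₂ h₁ g⁻¹ (fun b => by rw [← hg, smul_inv_smul]) (g x) hx
  have h3 : g⁻¹ (g x) = x := by rw [← AlgEquiv.mul_apply, inv_mul_cancel]; rfl
  rwa [h3] at this

theorem isInvariant_int [IsGalois F E] (R : ValuationSubring F) :
    Algebra.IsInvariant R (integralClosure R E) (E ≃ₐ[F] E) := by
  constructor
  intro b hb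
  have : ∃ a : F, algebraMap F E a = b := by
    have : (b : E) ∈ (⊥ : IntermediateField F E) := by
      rw [InfiniteGalois.mem_bot_iff_fixed]
      intro f
      have := congrArg Subtype.val (hb f)
      rwa [integralClosure.coe_smul] at this
    exact IntermediateField.mem_bot.mp this
  obtain ⟨a, ha⟩ := this
  have hai : IsIntegral R a := by
    have := b.2
    rw [mem_integralClosure_iff, ← ha] at this
    exact (isIntegral_algebraMap_iff (algebraMap F E).injective).mp this
  obtain ⟨r, hr⟩ := IsIntegrallyClosed.isIntegral_iff.mp hai
  refine ⟨r, Subtype.ext ?_⟩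
  rw [← ha, ← hr]; rfl

theorem val_trans [IsGalois F E] {O₁ O₂ : ValuationSubring E}
    (h : O₁.comap (algebraMap F E) = O₂.comap (algebraMap F E)) :
    ∃ g : E ≃ₐ[F] E, ∀ x, g x ∈ O₂ ↔ x ∈ O₁ := by
  set R := O₂.comap (algebraMap F E) with hR
  let : TopologicalSpace (integralClosure R E) := ⊥
  have : DiscreteTopology (integralClosure R E) := ⟨rfl⟩
  have := isInvariant_int (F := F) (E := E) R
  have : ContinuousSMul (E ≃ₐ[F] E) (integralClosure R E) := by
    rw [continuousSMul_iff_stabilizer_isOpen]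
    intro x
    convert stabilizer_isOpen_of_isIntegral (K := F) (L := E) (x : E) using 1
    ext g
    simp only [SetLike.mem_coe, MulAction.mem_stabilizer_iff, ← Subtype.coe_inj, integralClosure.coe_smul]
  obtain ⟨g, hg⟩ := Algebra.IsInvariant.exists_smul_of_under_eq_of_profinite (A := R) (G := E ≃ₐ[F] E)
    (Qid R O₁ h) (Qid R O₂ rfl) (by
      ext r
      rw [Ideal.mem_comap, Ideal.mem_comap, mem_Qid, mem_Qid, val_lt_one_iff', val_lt_one_iff']
      have e : (((algebraMap R (integralClosure R E)) r : integralClosure R E) : E) = algebraMap F E r := rfl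
      rw [e, ← map_inv₀, ← ValuationSubring.mem_comap, ← ValuationSubring.mem_comap, h])
  refine ⟨g, dec_of h rfl g fun b => ?_⟩
  rw [hg, Ideal.smul_mem_pointwise_smul_iff]

theorem val_surj [IsGalois F E] (O : ValuationSubring E)
    (φ : IsLocalRing.ResidueField O ≃+* IsLocalRing.ResidueField O)
    (hφ : ∀ (r : F) (hr : algebraMap F E r ∈ O), φ (IsLocalRing.residue O ⟨_, hr⟩) =
      IsLocalRing.residue O ⟨_, hr⟩) :
    ∃ g : E ≃ₐ[F] E, ∃ hg : (∀ x, g x ∈ O ↔ x ∈ O),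
      ∀ x : O, IsLocalRing.residue O ⟨g x, (hg x).mpr x.2⟩ = φ (IsLocalRing.residue O x) := by
  set R := O.comap (algebraMap F E) with hR
  let : TopologicalSpace (integralClosure R E) := ⊥
  have : DiscreteTopology (integralClosure R E) := ⟨rfl⟩
  have := isInvariant_int (F := F) (E := E) R
  have : ContinuousSMul (E ≃ₐ[F] E) (integralClosure R E) := by
    rw [continuousSMul_iff_stabilizer_isOpen]
    intro x
    convert stabilizer_isOpen_of_isIntegral (K := F) (L := E) (x : E) using 1
    ext g
    simp only [SetLike.mem_coe, MulAction.mem_stabilizer_iff, ← Subtype.coe_inj, integralClosure.coe_smul]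
  let Q := Qid R O rfl
  let f : integralClosure R E →+* IsLocalRing.ResidueField O := (IsLocalRing.residue O).comp (toO R O rfl)
  have hf : Function.Surjective f := by
    intro y
    obtain ⟨x, rfl⟩ := IsLocalRing.residue_surjective y
    obtain ⟨s, t, hs, hs1, hst⟩ := exists_frac (R := R) rfl x.1 x.2
    refine ⟨t, ?_⟩
    simp only [f, RingHom.comp_apply]
    rw [residue_eq_iff, toO_coe, ← hst]
    rw [← sub_one_mul, map_mul]
    exact mul_lt_one_of_lt_of_le hs ((O.valuation_le_one_iff _).mpr x.2)
  have hk : RingHom.ker f = Q := by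
    ext b
    rw [RingHom.mem_ker, mem_Qid, RingHom.comp_apply, ← map_zero (IsLocalRing.residue O), residue_eq_iff]
    simp
  let e : (integralClosure R E ⧸ Q) ≃+* IsLocalRing.ResidueField O :=
    (Ideal.quotEquivOfEq hk.symm).trans (RingHom.quotientKerEquivOfSurjective hf)
  have he : ∀ b : integralClosure R E, e (Ideal.Quotient.mk Q b) = f b := fun b => rfl
  let ψ : (integralClosure R E ⧸ Q) ≃ₐ[R ⧸ (Q.under R)] (integralClosure R E ⧸ Q) :=
    AlgEquiv.ofRingEquiv (f := (e.trans φ).trans e.symm) (by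
      intro r
      obtain ⟨r, rfl⟩ := Ideal.Quotient.mk_surjective r
      have : (algebraMap (R ⧸ (Q.under R)) (integralClosure R E ⧸ Q)) (Ideal.Quotient.mk _ r) =
        Ideal.Quotient.mk Q (algebraMap R _ r) := rfl
      rw [this, RingEquiv.trans_apply, RingEquiv.trans_apply, he, RingEquiv.symm_apply_eq, he]
      exact hφ r r.2)
  obtain ⟨g, hg⟩ := Ideal.Quotient.stabilizerHom_surjective_of_profinite (G := E ≃ₐ[F] E) (Q.under R) Q ψ
  have hgb : ∀ b : integralClosure R E, f (g.1 • b) = φ (f b) := by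
    intro b
    have h1 : Ideal.Quotient.stabilizerHom Q (Q.under R) (E ≃ₐ[F] E) g (Ideal.Quotient.mk Q b) = 
      Ideal.Quotient.mk Q (g.1 • b) := rfl
    rw [hg] at h1
    rw [← he, ← h1]
    have h2 : ψ (Ideal.Quotient.mk Q b) = e.symm (φ (e (Ideal.Quotient.mk Q b))) := rfl
    rw [h2, RingEquiv.apply_symm_apply, he]
  have hdec := dec_of (R := R) (O₁ := O) (O₂ := O) rfl rfl g.1 (fun b => by
    change g.1 • b ∈ Q ↔ b ∈ Q
    have hk' : ∀ b, b ∈ Q ↔ f b = 0 := fun b => by rw [← hk, RingHom.mem_ker]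
    rw [hk', hk', hgb, map_eq_zero])
  refine ⟨g.1, hdec, fun x => ?_⟩
  obtain ⟨s, t, hs, hs1, hst⟩ := exists_frac (R := R) rfl x.1 x.2
  have h1 : f s * IsLocalRing.residue O x = f t := by
    simp only [f, RingHom.comp_apply]
    rw [← map_mul]
    congr 1
    exact Subtype.ext hst
  have hs' : f s = 1 := by
    simp only [f, RingHom.comp_apply]
    rw [← map_one (IsLocalRing.residue O), residue_eq_iff]
    exact hs
  rw [hs', one_mul] at h1
  have h2 : f (g.1 • s) * IsLocalRing.residue O ⟨g.1 x, (hdec x).mpr x.2⟩ = f (g.1 • t) := by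
    simp only [f, RingHom.comp_apply]
    rw [← map_mul]
    congr 1
    apply Subtype.ext
    change g.1 (s : E) * g.1 (x:E) = g.1 (t : E)
    rw [← map_mul, hst]
  rw [hgb, hgb, hs', map_one, one_mul] at h2
  rw [h2, h1]

end ValTheory2


section ResExt

variable {F E : Type*} [Field F] [Field E] [Algebra F E]

/-- inclusion of valuation rings -/
noncomputable def incO (O : ValuationSubring E) : (O.comap (algebraMap F E)) →+* O :=
  ((algebraMap F E).comp (O.comap (algebraMap F E)).subtype).codRestrict O.toSubring (fun x => x.2)

theorem incO_coe (O : ValuationSubring E) (x : O.comap (algebraMap F E)) :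
    ((incO O x : O) : E) = algebraMap F E x := rfl

instance (O : ValuationSubring E) : IsLocalHom (incO (F := F) O) := by
  constructor
  intro a ha
  have ha0 : (a : F) ≠ 0 := by
    intro h
    have : incO (F := F) O a = 0 := Subtype.ext (by rw [incO_coe, h, map_zero]; rfl)
    rw [this] at ha
    exact not_isUnit_zero ha
  obtain ⟨u, hu⟩ := ha
  have h1 : algebraMap F E a * ((u⁻¹ : Oˣ) : O) = 1 := by
    rw [← incO_coe, ← hu]
    exact congrArg Subtype.val u.mul_inv
  have h2 : (a : F)⁻¹ ∈ O.comap (algebraMap F E) := by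
    rw [ValuationSubring.mem_comap, map_inv₀, inv_eq_of_mul_eq_one_right h1]
    exact (((u⁻¹ : Oˣ) : O)).2
  refine IsUnit.of_mul_eq_one ⟨_, h2⟩ (Subtype.ext ?_)
  exact mul_inv_cancel₀ ha0

noncomputable instance resAlg (O : ValuationSubring E) :
    Algebra (IsLocalRing.ResidueField (O.comap (algebraMap F E))) (IsLocalRing.ResidueField O) :=
  (IsLocalRing.ResidueField.map (incO (F := F) O)).toAlgebra

theorem resAlg_residue (O : ValuationSubring E) (r : O.comap (algebraMap F E)) :
    algebraMap (IsLocalRing.ResidueField (O.comap (algebraMap F E))) (IsLocalRing.ResidueField O)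
      (IsLocalRing.residue _ r) = IsLocalRing.residue O (incO O r) := rfl

theorem residue_lift_int [Algebra.IsAlgebraic F E] (O : ValuationSubring E)
    (y : IsLocalRing.ResidueField O) :
    ∃ b : integralClosure (O.comap (algebraMap F E)) E,
      IsLocalRing.residue O (toO _ O rfl b) = y := by
  obtain ⟨x, rfl⟩ := IsLocalRing.residue_surjective y
  obtain ⟨s, t, hs, hs1, hst⟩ := exists_frac (F := F) (O := O) rfl x.1 x.2
  refine ⟨t, ?_⟩
  rw [residue_eq_iff, toO_coe, ← hst]
  rw [← sub_one_mul, map_mul]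
  exact mul_lt_one_of_lt_of_le hs ((O.valuation_le_one_iff _).mpr x.2)

open Polynomial in
theorem res_normal [Normal F E] (O : ValuationSubring E) :
    Normal (IsLocalRing.ResidueField (O.comap (algebraMap F E))) (IsLocalRing.ResidueField O) := by
  set R := O.comap (algebraMap F E) with hR
  have key : ∀ y : IsLocalRing.ResidueField O, ∃ f : (IsLocalRing.ResidueField R)[X],
      f.Monic ∧ aeval y f = 0 ∧ (f.map (algebraMap _ (IsLocalRing.ResidueField O))).Splits := by
    intro y
    obtain ⟨b, rfl⟩ := residue_lift_int (F := F) O y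
    have hbi : IsIntegral R (b : E) := b.2
    let P := minpoly R (b : E)
    have hPm : P.Monic := minpoly.monic hbi
    have hPF : minpoly F (b : E) = P.map (algebraMap R F) :=
      minpoly.isIntegrallyClosed_eq_field_fractions' F hbi
    have hPE : (P.map (algebraMap R E)).Splits := by
      rw [IsScalarTower.algebraMap_eq R F E, ← Polynomial.map_map, ← hPF]
      exact Normal.splits inferInstance _
    have hcomp : (algebraMap R E) = (O.subtype).comp (incO (F := F) O) := rfl
    have hPO : (P.map (incO (F := F) O)).Splits := by
      refine Splits.of_splits_map_of_injective (i := O.subtype) Subtype.val_injective ?_ ?_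
      · rw [Polynomial.map_map, ← hcomp]; exact hPE
      · intro a ha
        rw [Polynomial.map_map, ← hcomp] at ha
        have : IsIntegral R a := ⟨P, hPm, by
          have := (mem_roots'.mp ha).2
          rwa [IsRoot.def, eval_map] at this⟩
        exact ⟨⟨a, mem_val_of_isIntegral O a this⟩, rfl⟩
    have hc2 : (algebraMap (IsLocalRing.ResidueField R) (IsLocalRing.ResidueField O)).comp
        (IsLocalRing.residue R) = (IsLocalRing.residue O).comp (incO (F := F) O) := rfl
    refine ⟨P.map (IsLocalRing.residue R), hPm.map _, ?_, ?_⟩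
    · rw [aeval_def, eval₂_map, hc2, ← hom_eval₂]
      have : eval₂ (incO (F := F) O) (toO R O rfl b) P = 0 := by
        apply Subtype.ext
        change O.subtype _ = 0
        rw [hom_eval₂, ← hcomp]
        exact minpoly.aeval R (b : E)
      rw [this, map_zero]
    · rw [Polynomial.map_map, hc2, ← Polynomial.map_map]
      exact hPO.map _
  have halg : Algebra.IsAlgebraic (IsLocalRing.ResidueField R) (IsLocalRing.ResidueField O) := by
    constructor
    intro y
    obtain ⟨f, hf, hfy, -⟩ := key y
    exact ⟨f, hf.ne_zero, hfy⟩
  refine { toIsAlgebraic := halg, splits' := fun y => ?_ }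
  obtain ⟨f, hf, hfy, hfs⟩ := key y
  exact hfs.of_dvd (hf.map _).ne_zero (Polynomial.map_dvd _ (minpoly.dvd _ _ hfy))

theorem dec_val_lt {O : ValuationSubring E} {g : E ≃ₐ[F] E} (hg : ∀ x, g x ∈ O ↔ x ∈ O) (x : E) :
    O.valuation (g x) < 1 ↔ O.valuation x < 1 := by
  rw [val_lt_one_iff', val_lt_one_iff', ← map_inv₀, hg, map_eq_zero]

theorem trace_lemma [FiniteDimensional F E] [IsGalois F E] (O : ValuationSubring E)
    (hcard : ∀ d : ℕ, d ∣ Nat.card (E ≃ₐ[F] E) → O.valuation (d : E) = 1) (p : ℕ) [ExpChar E p]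
    (b : E) (hb : b ∈ O) (n : ℕ) (r : F) (h : O.valuation (b ^ p ^ n - algebraMap F E r) < 1) :
    ∃ r' : F, O.valuation (b - algebraMap F E r') < 1 := by
  classical
  set v := O.valuation with hv
  have vadd : ∀ {x y : E}, v x < 1 → v y < 1 → v (x + y) < 1 := fun hx hy =>
    lt_of_le_of_lt (v.map_add _ _) (max_lt hx hy)
  have vsub : ∀ {x y : E}, v x < 1 → v y < 1 → v (x - y) < 1 := fun hx hy =>
    lt_of_le_of_lt (v.map_sub _ _) (max_lt hx hy)
  have vswap : ∀ {x y : E}, v (x - y) < 1 → v (y - x) < 1 := fun hx => by rwa [v.map_sub_swap]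
  have vmul : ∀ {x y : E}, v x < 1 → v y ≤ 1 → v (x * y) < 1 := fun hx hy => by
    rw [map_mul]; exact mul_lt_one_of_lt_of_le hx hy
  have vpow : ∀ {x : E} (m : ℕ), v (x ^ p ^ m) < 1 ↔ v x < 1 := fun {x} m => by
    rw [map_pow]; exact pow_lt_one_iff (pow_ne_zero _ (expChar_ne_zero E p))
  -- reduce to integral b
  wlog hbi : IsIntegral (O.comap (algebraMap F E)) b generalizing b with H
  · obtain ⟨s, t, hs, hs1, hst⟩ := exists_frac (F := F) (O := O) rfl b hb
    have htb : v ((t:E) - b) < 1 := by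
      rw [← hst, ← sub_one_mul]
      exact vmul hs ((O.valuation_le_one_iff _).mpr hb)
    obtain ⟨r', hr'⟩ := H (t : E) (toO _ O rfl t).2 (by
      have : (t : E) ^ p ^ n - algebraMap F E r = ((t:E) - b) ^ p ^ n + (b ^ p ^ n - algebraMap F E r) := by
        rw [sub_pow_expChar_pow]; ring
      rw [this]
      exact vadd ((vpow n).mpr htb) h) t.2
    refine ⟨r', ?_⟩
    have : b - algebraMap F E r' = ((t:E) - algebraMap F E r') - (t - b) := by ring
    rw [this]; exact vsub hr' htb
  set R := O.comap (algebraMap F E) with hR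
  let B := integralClosure R E
  let Q := Qid R O rfl
  let D : Subgroup (E ≃ₐ[F] E) := decompSubgroup O
  have hQ : ∀ b : B, b ∈ Q ↔ v (b : E) < 1 := fun b => mem_Qid rfl b
  have vB : ∀ b : B, v (b : E) ≤ 1 := fun b => val_int rfl b
  -- separating elements
  have sep : ∀ g : E ≃ₐ[F] E, g ∉ D → ∃ c : B, c ∉ Q ∧ g • c ∈ Q := by
    intro g hg
    by_contra hcon
    push Not at hcon
    have hcon' : ∀ c : B, g • c ∈ Q → c ∈ Q := fun c hc => by
      by_contra h; exact hcon c h hc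
    apply hg
    refine dec_of (R := R) rfl rfl g fun c => ⟨hcon' c, fun hc => ?_⟩
    have hpow : ∀ (m : ℕ) (c : B), g ^ m • c ∈ Q → c ∈ Q := by
      intro m
      induction m with
      | zero => intro c hc; simpa using hc
      | succ m ih => intro c hc; rw [pow_succ, mul_smul] at hc; exact hcon' _ (ih _ hc)
    obtain ⟨m, hm⟩ : ∃ m, orderOf g = m + 1 := ⟨orderOf g - 1, by have := orderOf_pos g; omega⟩
    apply hpow m
    rw [← mul_smul, ← pow_succ, ← hm, pow_orderOf_eq_one, one_smul]
    exact hc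
  choose! cc hcc1 hcc2 using sep
  let c : B := ∏ g ∈ Finset.univ.filter (fun g => g ∉ D), cc g
  have hc1 : c ∉ Q := by
    intro hc
    obtain ⟨g, hg, hgQ⟩ := (Ideal.IsPrime.prod_mem_iff (p := Q)).mp hc
    exact hcc1 g (Finset.mem_filter.mp hg).2 hgQ
  have hc2 : ∀ g, g ∉ D → g • c ∈ Q := by
    intro g hg
    have : c = cc g * ∏ g' ∈ (Finset.univ.filter (fun g => g ∉ D)).erase g, cc g' :=
      (Finset.mul_prod_erase _ cc (a := g) (Finset.mem_filter.mpr ⟨Finset.mem_univ _, hg⟩)).symm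
    rw [this, smul_mul']
    exact Ideal.mul_mem_right _ _ (hcc2 g hg)
  have hvc : v (c : E) = 1 := le_antisymm (vB c) (not_lt.mp fun h => hc1 ((hQ c).mpr h))
  have hc0 : (c : E) ≠ 0 := by
    intro h0; rw [h0, map_zero] at hvc; exact zero_ne_one hvc
  obtain ⟨s, t, hs, hs1, hst⟩ := exists_frac (F := F) (R := R) (O := O) rfl ((c : E)⁻¹)
    ((O.valuation_le_one_iff _).mp (by rw [map_inv₀]; change (v c)⁻¹ ≤ 1; rw [hvc, inv_one]))
  let e : E := c * t
  have he1 : v (e - 1) < 1 := by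
    have : e = s := by
      change (c : E) * t = s
      rw [← hst, mul_comm (s:E), ← mul_assoc, mul_inv_cancel₀ hc0, one_mul]
    rw [this]; exact hs
  have hgB : ∀ (g : E ≃ₐ[F] E) (x : B), v (g (x : E)) ≤ 1 := fun g x => by
    have := vB (g • x)
    rwa [integralClosure.coe_smul] at this
  have he2 : ∀ g, g ∉ D → v (g (e * b)) < 1 := by
    intro g hg
    have h1 : v (g (c : E)) < 1 := by
      have := (hQ _).mp (hc2 g hg)
      rwa [integralClosure.coe_smul] at this
    have h2 : g (e * b) = g (c : E) * g ((t * ⟨b, hbi⟩ : B) : E) := by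
      simp [e]; ring
    rw [h2]
    exact vmul h1 (hgB _ _)
  have he3 : ∀ g, g ∈ D → v (g (e * b) - b) < 1 := by
    intro g hg
    have h1 : v (g ((e - 1) * b)) < 1 := (dec_val_lt hg _).mpr (vmul he1 ((O.valuation_le_one_iff _).mpr hb))
    have h2 : v (g b - b) < 1 := by
      rw [← vpow n, sub_pow_expChar_pow, ← map_pow]
      have h3 : v (g (b ^ p ^ n - algebraMap F E r)) < 1 := (dec_val_lt hg _).mpr h
      rw [map_sub, AlgEquiv.commutes] at h3
      have : g (b ^ p ^ n) - b ^ p ^ n = (g (b ^ p ^ n) - algebraMap F E r) - (b ^ p ^ n - algebraMap F E r) := by ring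
      rw [this]; exact vsub h3 h
    have : g (e * b) - b = g ((e-1) * b) + (g b - b) := by
      rw [sub_mul, one_mul, map_sub]; ring
    rw [this]; exact vadd h1 h2
  let N : ℕ := Nat.card D
  have hN : v (N : E) = 1 := hcard N (Subgroup.card_subgroup_dvd_card D)
  have hN0 : (N : E) ≠ 0 := by
    intro h0; rw [h0, map_zero] at hN; exact zero_ne_one hN
  have htr : v (algebraMap F E (Algebra.trace F E (e * b)) - N * b) < 1 := by
    rw [trace_eq_sum_automorphisms]
    have hNb : (N : E) * b = ∑ g : E ≃ₐ[F] E, if g ∈ D then b else 0 := by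
      rw [← Finset.sum_filter, Finset.sum_const, nsmul_eq_mul]
      congr 2
      simp only [N]
      rw [Nat.card_eq_fintype_card, Fintype.card_subtype]
    rw [hNb, ← Finset.sum_sub_distrib]
    refine Valuation.map_sum_lt _ one_ne_zero fun g _ => ?_
    split_ifs with hg
    · exact he3 g hg
    · rw [sub_zero]; exact he2 g hg
  refine ⟨Algebra.trace F E (e * b) / N, ?_⟩
  have : b - algebraMap F E (Algebra.trace F E (e * b) / N) =
      - ((algebraMap F E (Algebra.trace F E (e * b)) - N * b) * (N : E)⁻¹) := by
    rw [map_div₀, map_natCast]; field_simp; ring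
  rw [this, Valuation.map_neg]
  exact vmul htr (by rw [map_inv₀, hN, inv_one])

end ResExt


theorem sep_of_normal {F E : Type*} [Field F] [Field E] [Algebra F E] [Normal F E]
    (h : perfectClosure F E = ⊥) : Algebra.IsSeparable F E := by
  classical
  have fix : ∀ c : E, (∀ g : E ≃ₐ[F] E, g c = c) → c ∈ (⊥ : IntermediateField F E) := by
    intro c hc
    rw [← h, mem_perfectClosure_iff_natSepDegree_eq_one,
      Polynomial.natSepDegree_eq_of_splits (E := E) _ (Normal.splits inferInstance c)]
    rw [Finset.card_eq_one]
    refine ⟨c, ?_⟩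
    have hint : IsIntegral F c := Normal.isIntegral inferInstance c
    ext d
    rw [Multiset.mem_toFinset, Finset.mem_singleton, Polynomial.mem_aroots]
    constructor
    · rintro ⟨-, hd⟩
      obtain ⟨g, hg⟩ := exists_algHom_of_splits_of_aeval (K := E) (E := E) (F := F)
        (fun s => ⟨Normal.isIntegral inferInstance s, Normal.splits inferInstance s⟩) hd
      have : g = (AlgEquiv.ofBijective g (Algebra.IsAlgebraic.algHom_bijective g) : E →ₐ[F] E) := rfl
      rw [← hg]
      exact hc (AlgEquiv.ofBijective g (Algebra.IsAlgebraic.algHom_bijective g))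
    · rintro rfl
      exact ⟨minpoly.ne_zero hint, minpoly.aeval _ _⟩
  constructor
  intro y
  have hint : IsIntegral F y := Normal.isIntegral inferInstance y
  let S := ((minpoly F y).aroots E).toFinset
  let f : Polynomial E := ∏ a ∈ S, (Polynomial.X - Polynomial.C a)
  have hS : ∀ (g : E ≃ₐ[F] E) (a : E), g a ∈ S ↔ a ∈ S := by
    intro g a
    simp only [S, Multiset.mem_toFinset, Polynomial.mem_aroots]
    rw [← AlgEquiv.coe_toAlgHom, Polynomial.aeval_algHom_apply]
    simp
  have hfg : ∀ g : E ≃ₐ[F] E, f.map (g : E →+* E) = f := by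
    intro g
    simp only [f]
    rw [Polynomial.map_prod]
    simp only [Polynomial.map_sub, Polynomial.map_X, Polynomial.map_C]
    refine Finset.prod_bij (fun a _ => g a) (fun a ha => (hS g a).mpr ha)
      (fun a _ b _ hab => g.injective hab)
      (fun b hb => ⟨g.symm b, (hS g _).mp (by simpa using hb), by simp⟩) (fun a _ => rfl)
  have hlift : f ∈ Polynomial.lifts (algebraMap F E) := by
    rw [Polynomial.lifts_iff_coeff_lifts]
    intro n
    have := fix (f.coeff n) (fun g => by
      conv_rhs => rw [← hfg g]
      rw [Polynomial.coeff_map]; rfl)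
    exact IntermediateField.mem_bot.mp this
  obtain ⟨f₀, hf₀⟩ := hlift
  have hf₀ : f₀.map (algebraMap F E) = f := hf₀
  have hsep : f₀.Separable := by
    rw [← Polynomial.separable_map (algebraMap F E), hf₀]
    exact Polynomial.separable_prod_X_sub_C_iff'.mpr (fun a _ b _ hab => hab)
  have hroot : Polynomial.aeval y f₀ = 0 := by
    rw [Polynomial.aeval_def, ← Polynomial.eval_map, hf₀]
    simp only [f, Polynomial.eval_prod]
    refine Finset.prod_eq_zero (i := y) ?_ (by simp)
    simp only [S, Multiset.mem_toFinset, Polynomial.mem_aroots]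
    exact ⟨minpoly.ne_zero hint, minpoly.aeval _ _⟩
  exact hsep.of_dvd (minpoly.dvd _ _ hroot)

section ResProL

variable (ℓ : ℕ) [Fact ℓ.Prime] (K : Type*) [Field K]

instance instGalProL : IsGalois K (proL ℓ K) := proL_isGalois ℓ K

theorem galL_pow_fix (x : proL ℓ K) : ∃ n : ℕ, ∀ σ : GalL ℓ K, (σ ^ (ℓ ^ n)) x = x := by
  have hx : (x : AlgebraicClosure K) ∈ proLAux ℓ K := (proL_eq ℓ K) ▸ x.2
  obtain ⟨-, n, hn⟩ := hx
  refine ⟨n, fun σ => ?_⟩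
  have h1 := hn (σ.liftNormal (AlgebraicClosure K))
  have h2 : ∀ m : ℕ, ((σ.liftNormal (AlgebraicClosure K)) ^ m) (x : AlgebraicClosure K) =
      ((σ ^ m) x : proL ℓ K) := by
    intro m
    induction m with
    | zero => rfl
    | succ m ih =>
      rw [pow_succ', AlgEquiv.mul_apply, ih, pow_succ', AlgEquiv.mul_apply]
      exact AlgEquiv.liftNormal_commutes σ (AlgebraicClosure K) _
  rw [h2] at h1
  exact Subtype.ext h1

theorem isPGroup_sub (L : IntermediateField K (proL ℓ K)) [FiniteDimensional K L] [IsGalois K L] :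
    IsPGroup ℓ (L ≃ₐ[K] L) := by
  intro g
  obtain ⟨α, hα⟩ := Field.exists_primitive_element K L
  obtain ⟨n, hn⟩ := galL_pow_fix ℓ K (α : proL ℓ K)
  refine ⟨n, ?_⟩
  obtain ⟨σ, rfl⟩ := AlgEquiv.restrictNormalHom_surjective (F := K) (K₁ := L) (E := proL ℓ K) g
  rw [← map_pow]
  set h := AlgEquiv.restrictNormalHom L (σ ^ ℓ ^ n) with hh
  have hα2 : h α = α := by
    apply Subtype.ext
    have := AlgEquiv.restrictNormal_commutes (σ ^ ℓ ^ n) L α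
    exact this.trans (hn σ)
  have : K⟮α⟯ ≤ IntermediateField.fixedField (Subgroup.zpowers h) := by
    rw [adjoin_le_iff, Set.singleton_subset_iff]
    rintro ⟨m, hm⟩
    have : Subgroup.zpowers h ≤ MulAction.stabilizer _ α := by
      rw [Subgroup.zpowers_le]; exact hα2
    exact this hm
  rw [hα] at this
  ext x
  have h5 : h x = x := this (mem_top (x := x)) ⟨h, Subgroup.mem_zpowers h⟩
  rw [h5]; rfl

variable {ℓ K}

theorem comap_val_lt {F E : Type*} [Field F] [Field E] [Algebra F E] (O : ValuationSubring E) (x : F) :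
    (O.comap (algebraMap F E)).valuation x < 1 ↔ O.valuation (algebraMap F E x) < 1 := by
  rw [val_lt_one_iff', val_lt_one_iff', ValuationSubring.mem_comap, map_inv₀, map_eq_zero]

theorem comap_val_le {F E : Type*} [Field F] [Field E] [Algebra F E] (O : ValuationSubring E) (x : F) :
    (O.comap (algebraMap F E)).valuation x ≤ 1 ↔ O.valuation (algebraMap F E x) ≤ 1 := by
  rw [ValuationSubring.valuation_le_one_iff, ValuationSubring.valuation_le_one_iff,
    ValuationSubring.mem_comap]

theorem res_perfect (p : ℕ) [Fact p.Prime] [CharP K p] (O : ValuationSubring (proL ℓ K))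
    (hvℓ : O.valuation (ℓ : proL ℓ K) = 1) :
    perfectClosure (IsLocalRing.ResidueField (O.comap (algebraMap K (proL ℓ K))))
      (IsLocalRing.ResidueField O) = ⊥ := by
  rw [eq_bot_iff]
  intro y hy
  have hcR : CharP (O.comap (algebraMap K (proL ℓ K))) p :=
    (RingHom.charP_iff (O.comap (algebraMap K (proL ℓ K))).subtype Subtype.val_injective p).mpr ‹_›
  have : CharP (IsLocalRing.ResidueField (O.comap (algebraMap K (proL ℓ K)))) p := by
    have h0 : ((p : ℕ) : IsLocalRing.ResidueField (O.comap (algebraMap K (proL ℓ K)))) = 0 := by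
      rw [← map_natCast (IsLocalRing.residue _), CharP.cast_eq_zero, map_zero]
    exact (CharP.charP_iff_prime_eq_zero Fact.out).mpr h0
  have hE : ExpChar K p := .prime Fact.out
  have : ExpChar (IsLocalRing.ResidueField (O.comap (algebraMap K (proL ℓ K)))) p := .prime Fact.out
  rw [mem_perfectClosure_iff_pow_mem p] at hy
  obtain ⟨n, z, hz⟩ := hy
  obtain ⟨b, rfl⟩ := IsLocalRing.residue_surjective y
  obtain ⟨r, rfl⟩ := IsLocalRing.residue_surjective z
  rw [resAlg_residue, ← map_pow, eq_comm, residue_eq_iff] at hz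
  let L : IntermediateField K (proL ℓ K) := normalClosure K K⟮(b : proL ℓ K)⟯ (proL ℓ K)
  have hfd : FiniteDimensional K K⟮(b : proL ℓ K)⟯ :=
    adjoin.finiteDimensional (Algebra.IsIntegral.isIntegral _)
  have hbL : (b : proL ℓ K) ∈ L := by
    have h1 : K⟮(b : proL ℓ K)⟯ ≤ L := le_normalClosure _
    exact h1 (mem_adjoin_simple_self K _)
  have hGL : IsGalois K L := ⟨⟩
  let OL := O.comap (algebraMap L (proL ℓ K))
  have hcomapv : ∀ x : L, OL.valuation x < 1 ↔ O.valuation (x : proL ℓ K) < 1 :=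
    fun x => comap_val_lt O x
  have hvl : OL.valuation (ℓ : L) = 1 := by
    apply le_antisymm
    · rw [comap_val_le, map_natCast]; exact hvℓ.le
    · rw [← not_lt, comap_val_lt, map_natCast, not_lt]; exact hvℓ.ge
  have hcard : ∀ d : ℕ, d ∣ Nat.card (L ≃ₐ[K] L) → OL.valuation (d : L) = 1 := by
    intro d hd
    obtain ⟨m, hm⟩ := IsPGroup.iff_card.mp (isPGroup_sub ℓ K L)
    rw [hm] at hd
    obtain ⟨j, -, rfl⟩ := (Nat.dvd_prime_pow Fact.out).mp hd
    rw [Nat.cast_pow, map_pow, hvl, one_pow]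
  have : ExpChar L p := expChar_of_injective_algebraMap (algebraMap K L).injective p
  obtain ⟨r', hr'⟩ := trace_lemma (F := K) OL hcard p ⟨b, hbL⟩ b.2 n (r : K) ((hcomapv _).mpr hz)
  rw [hcomapv] at hr'
  have hr'R : r' ∈ O.comap (algebraMap K (proL ℓ K)) := by
    rw [ValuationSubring.mem_comap, ← ValuationSubring.valuation_le_one_iff]
    have e : algebraMap K (proL ℓ K) r' = b - ((b : proL ℓ K) - algebraMap K (proL ℓ K) r') := by ring
    rw [e]
    exact (Valuation.map_sub _ _ _).trans (max_le ((O.valuation_le_one_iff _).mpr b.2) hr'.le)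
  rw [IntermediateField.mem_bot]
  refine ⟨IsLocalRing.residue _ ⟨r', hr'R⟩, ?_⟩
  rw [resAlg_residue, eq_comm, residue_eq_iff]
  exact hr'

theorem res_isGalois (p : ℕ) [Fact p.Prime] [CharP K p] (O : ValuationSubring (proL ℓ K))
    (hvℓ : O.valuation (ℓ : proL ℓ K) = 1) :
    IsGalois (IsLocalRing.ResidueField (O.comap (algebraMap K (proL ℓ K))))
      (IsLocalRing.ResidueField O) := by
  have h1 := res_normal (F := K) O
  have h2 := sep_of_normal (res_perfect p O hvℓ)
  exact ⟨⟩

end ResProL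


theorem cont_to_gal {G : Type*} [Group G] [TopologicalSpace G] [IsTopologicalGroup G]
    {F E : Type*} [Field F] [Field E] [Algebra F E] (ρ : G →* (E ≃ₐ[F] E))
    (h : ∀ x : E, ∃ U ∈ nhds (1 : G), ∀ g ∈ U, ρ g x = x) : Continuous ρ := by
  apply continuous_of_continuousAt_one
  intro S hS
  rw [map_one, krullTopology_mem_nhds_one_iff] at hS
  obtain ⟨L, hL, hLS⟩ := hS
  obtain ⟨T, hT⟩ := (IntermediateField.fg_def.mp (L.fg_of_fg_toSubalgebra (Subalgebra.fg_of_fg_toSubmodule ((Submodule.fg_top _).mp hL.fg_top))))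
  choose U hU1 hU2 using h
  have hTf : T.Finite := hT.1
  have : (⋂ x ∈ T, U x) ∈ nhds (1 : G) := (Filter.biInter_mem hTf).mpr fun x _ => hU1 x
  refine Filter.mem_map.mpr (Filter.mem_of_superset this fun g hg => hLS ?_)
  rw [SetLike.mem_coe, ← Subgroup.zpowers_le, ← IntermediateField.le_iff_le, ← hT.2, adjoin_le_iff]
  intro x hx
  rintro ⟨m, hm⟩
  have : Subgroup.zpowers (ρ g) ≤ MulAction.stabilizer _ x := by
    rw [Subgroup.zpowers_le]
    exact hU2 x g (Set.mem_iInter₂.mp hg x hx)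
  exact this hm

section ResAut

variable {F E : Type*} [Field F] [Field E] [Algebra F E] (O : ValuationSubring E)

/-- action on the valuation ring -/
def decO (σ : decompSubgroup (F := F) O) : O ≃+* O where
  toFun x := ⟨σ.1 x, (σ.2 x).mpr x.2⟩
  invFun x := ⟨σ.1⁻¹ x, ((inv_mem σ.2) x).mpr x.2⟩
  left_inv x := Subtype.ext (σ.1.symm_apply_apply x)
  right_inv x := Subtype.ext (σ.1.apply_symm_apply x)
  map_mul' x y := Subtype.ext (map_mul σ.1 _ _)
  map_add' x y := Subtype.ext (map_add σ.1 _ _)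

/-- action on the residue field -/
noncomputable def resAut : decompSubgroup (F := F) O →*
    (IsLocalRing.ResidueField O ≃ₐ[IsLocalRing.ResidueField (O.comap (algebraMap F E))]
      IsLocalRing.ResidueField O) where
  toFun σ := AlgEquiv.ofRingEquiv (f := IsLocalRing.ResidueField.mapEquiv (decO O σ)) (by
    intro y
    obtain ⟨r, rfl⟩ := IsLocalRing.residue_surjective y
    rw [resAlg_residue]
    change IsLocalRing.residue O (decO O σ (incO O r)) = _
    congr 1
    apply Subtype.ext
    exact σ.1.commutes r)
  map_one' := by
    ext y
    obtain ⟨r, rfl⟩ := IsLocalRing.residue_surjective y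
    rfl
  map_mul' σ τ := by
    ext y
    obtain ⟨r, rfl⟩ := IsLocalRing.residue_surjective y
    rfl

theorem resAut_residue (σ : decompSubgroup (F := F) O) (x : O) :
    resAut O σ (IsLocalRing.residue O x) = IsLocalRing.residue O (decO O σ x) := rfl

theorem resAut_eq_one (σ : decompSubgroup (F := F) O) :
    resAut O σ = 1 ↔ (σ : E ≃ₐ[F] E) ∈ inertiaSubgroup (F := F) O := by
  constructor
  · intro h
    refine ⟨σ.2, fun x hx => ?_⟩
    have := congrArg (fun f => f (IsLocalRing.residue O ⟨x, hx⟩)) h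
    simp only [resAut_residue, AlgEquiv.one_apply] at this
    exact (residue_eq_iff O _ _).mp this
  · rintro ⟨-, h⟩
    ext y
    obtain ⟨r, rfl⟩ := IsLocalRing.residue_surjective y
    rw [resAut_residue, AlgEquiv.one_apply, residue_eq_iff]
    exact h r r.2

theorem resAut_surj [IsGalois F E] : Function.Surjective (resAut (F := F) O) := by
  intro φ
  obtain ⟨g, hg, hgx⟩ := val_surj (F := F) O φ.toRingEquiv (fun r hr => by
    have := φ.commutes (IsLocalRing.residue _ ⟨r, hr⟩)
    exact this)
  refine ⟨⟨g, hg⟩, ?_⟩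
  ext y
  obtain ⟨r, rfl⟩ := IsLocalRing.residue_surjective y
  exact hgx r

end ResAut

section Ident

variable {ℓ : ℕ} [Fact ℓ.Prime] {k K : Type*} [Field k] [Field K] [Algebra k K] [IsAlgClosed k]

theorem val_ell (O : ValuationSubring (proL ℓ K))
    (hk : ∀ c : k, algebraMap k K c ∈ O.comap (algebraMap K (proL ℓ K)))
    (c : k) (hc : c ≠ 0) : O.valuation (algebraMap K (proL ℓ K) (algebraMap k K c)) = 1 := by
  apply le_antisymm
  · rw [O.valuation_le_one_iff]; exact hk c
  · have h := hk c⁻¹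
    rw [ValuationSubring.mem_comap, ← O.valuation_le_one_iff, map_inv₀, map_inv₀, map_inv₀] at h
    rwa [inv_le_one₀] at h
    rw [zero_lt_iff]; simp [hc]

theorem range_eq_proL (p : ℕ) [Fact p.Prime] [CharP k p] (hpℓ : p ≠ ℓ)
    (O : ValuationSubring (proL ℓ K))
    (hk : ∀ c : k, algebraMap k K c ∈ O.comap (algebraMap K (proL ℓ K)))
    (j : IsLocalRing.ResidueField O →ₐ[IsLocalRing.ResidueField (O.comap (algebraMap K (proL ℓ K)))]
      AlgebraicClosure (IsLocalRing.ResidueField (O.comap (algebraMap K (proL ℓ K))))) :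
    j.fieldRange = proL ℓ (IsLocalRing.ResidueField (O.comap (algebraMap K (proL ℓ K)))) := by
  have hlp : ℓ.Prime := Fact.out
  have hℓk : (ℓ : k) ≠ 0 := CharP.cast_ne_zero_of_ne_of_prime k hlp hpℓ
  have : CharP K p := charP_of_injective_algebraMap (algebraMap k K).injective p
  have hvℓ : O.valuation (ℓ : proL ℓ K) = 1 := by
    have := val_ell O hk ℓ hℓk
    simpa using this
  have hgal := res_isGalois p O hvℓ
  have : NeZero (ℓ : k) := ⟨hℓk⟩
  obtain ⟨ζ, hζ⟩ := HasEnoughRootsOfUnity.exists_primitiveRoot k ℓ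
  set R := O.comap (algebraMap K (proL ℓ K))
  have hζK : IsPrimitiveRoot (algebraMap k K ζ) ℓ := hζ.map_of_injective (algebraMap k K).injective
  have hζκ : IsPrimitiveRoot (resMap R hk ζ) ℓ := hζ.map_of_injective (resMap R hk).injective
  have hℓK : (ℓ : K) ≠ 0 := by
    rw [← map_natCast (algebraMap k K)]; rw [map_ne_zero]; exact hℓk
  have hℓκ : (ℓ : IsLocalRing.ResidueField R) ≠ 0 := by
    rw [← map_natCast (resMap R hk)]; rw [map_ne_zero]; exact hℓk
  apply le_antisymm
  · rintro _ ⟨y, rfl⟩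
    refine (proL_eq ℓ (IsLocalRing.ResidueField R)).ge ?_
    constructor
    · change j y ∈ separableClosure _ _
      rw [mem_separableClosure_iff, IsSeparable, minpoly.algHom_eq j j.toRingHom.injective]
      exact Algebra.IsSeparable.isSeparable _ y
    · obtain ⟨b, rfl⟩ := IsLocalRing.residue_surjective y
      obtain ⟨n, hn⟩ := galL_pow_fix ℓ K (b : proL ℓ K)
      refine ⟨n, fun σ => ?_⟩
      let _ : Algebra (IsLocalRing.ResidueField O) (AlgebraicClosure (IsLocalRing.ResidueField R)) :=
        j.toRingHom.toAlgebra
      have : IsScalarTower (IsLocalRing.ResidueField R) (IsLocalRing.ResidueField O)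
        (AlgebraicClosure (IsLocalRing.ResidueField R)) := IsScalarTower.of_algebraMap_eq fun x =>
          (j.commutes x).symm
      obtain ⟨s, hs⟩ := resAut_surj (F := K) O (σ.restrictNormal (IsLocalRing.ResidueField O))
      have h1 : ∀ (m : ℕ) , (σ ^ m) (j (IsLocalRing.residue O b)) =
          j (resAut O (s ^ m) (IsLocalRing.residue O b)) := by
        intro m
        induction m with
        | zero => rfl
        | succ m ih =>
          rw [pow_succ', AlgEquiv.mul_apply, ih, pow_succ', map_mul, AlgEquiv.mul_apply, hs]
          exact (AlgEquiv.restrictNormal_commutes σ (IsLocalRing.ResidueField O) _).symm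
      change (σ ^ ℓ ^ n) (j (IsLocalRing.residue O b)) = j (IsLocalRing.residue O b)
      rw [h1, resAut_residue]
      congr 2
      apply Subtype.ext
      exact hn s.1
  · refine proL_le hℓκ hζκ _ ?_
    rintro x ⟨y, hy⟩
    change j y = x ^ ℓ at hy
    by_cases hx0 : x = 0
    · rw [hx0]; exact zero_mem _
    obtain ⟨a, rfl⟩ := IsLocalRing.residue_surjective y
    obtain ⟨z, hz⟩ := IsAlgClosed.exists_pow_nat_eq (a : AlgebraicClosure K) hlp.pos
    have hzE : z ∈ proL ℓ K := proL_root hℓK hζK (by rw [hz]; exact (a : proL ℓ K).2)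
    have hza : (⟨z, hzE⟩ : proL ℓ K) ^ ℓ = a := Subtype.ext hz
    have hzO : (⟨z, hzE⟩ : proL ℓ K) ∈ O := by
      rw [← O.valuation_le_one_iff]
      have h := (O.valuation_le_one_iff _).mpr a.2
      rw [← hza, map_pow] at h
      exact (pow_le_one_iff hlp.ne_zero).mp h
    let w := j (IsLocalRing.residue O ⟨_, hzO⟩)
    have hw : w ^ ℓ = x ^ ℓ := by
      simp only [w]
      rw [← hy, ← map_pow, ← map_pow]
      congr 2
      exact Subtype.ext hza
    have hw0 : w ≠ 0 := by
      intro h0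
      rw [h0, zero_pow hlp.ne_zero] at hw
      exact hx0 (pow_eq_zero_iff hlp.ne_zero |>.mp hw.symm)
    have hζΩ := hζκ.map_of_injective (f := algebraMap (IsLocalRing.ResidueField R) (AlgebraicClosure (IsLocalRing.ResidueField R)))
      (algebraMap (IsLocalRing.ResidueField R) (AlgebraicClosure (IsLocalRing.ResidueField R))).injective
    have : NeZero ℓ := ⟨hlp.ne_zero⟩
    obtain ⟨i, -, hi⟩ := hζΩ.eq_pow_of_pow_eq_one (ξ := x / w) (by
      rw [div_pow, hw, div_self (pow_ne_zero _ hx0)])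
    have : x = (algebraMap _ (AlgebraicClosure (IsLocalRing.ResidueField R)) (resMap R hk ζ)) ^ i * w := by
      rw [hi, div_mul_cancel₀ _ hw0]
    rw [this]
    exact mul_mem (pow_mem (IntermediateField.algebraMap_mem _ _) _) ⟨_, rfl⟩

theorem exists_transfer {κ κ' : Type*} [Field κ] [Field κ'] [Algebra κ κ'] [Algebra.IsAlgebraic κ κ']
    (M : IntermediateField κ (AlgebraicClosure κ))
    (hM : ∀ j : κ' →ₐ[κ] AlgebraicClosure κ, j.fieldRange = M)
    {G : Type*} [Group G] [TopologicalSpace G] [IsTopologicalGroup G] (ρ0 : G →* (κ' ≃ₐ[κ] κ'))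
    (hs : Function.Surjective ρ0)
    (hc : ∀ x : κ', ∃ U ∈ nhds (1 : G), ∀ g ∈ U, ρ0 g x = x) :
    ∃ ρ : G →* (M ≃ₐ[κ] M), Continuous ρ ∧ Function.Surjective ρ ∧ ∀ g, ρ g = 1 ↔ ρ0 g = 1 := by
  let j : κ' →ₐ[κ] AlgebraicClosure κ := IsAlgClosed.lift
  have hj := hM j
  let ψ : κ' ≃ₐ[κ] M :=
    (AlgEquiv.ofInjectiveField j).trans (IntermediateField.equivOfEq hj)
  refine ⟨(AlgEquiv.autCongr ψ).toMonoidHom.comp ρ0, ?_, ?_, ?_⟩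
  · apply cont_to_gal
    intro x
    obtain ⟨U, hU, h⟩ := hc (ψ.symm x)
    refine ⟨U, hU, fun g hg => ?_⟩
    change ψ (ρ0 g (ψ.symm x)) = x
    rw [h g hg, AlgEquiv.apply_symm_apply]
  · exact (AlgEquiv.autCongr ψ).surjective.comp hs
  · intro σ
    exact (AlgEquiv.autCongr ψ).map_eq_one_iff

theorem exists_res (p : ℕ) [Fact p.Prime] [CharP k p] (hpℓ : p ≠ ℓ)
    (O : ValuationSubring (proL ℓ K))
    (hk : ∀ c : k, algebraMap k K c ∈ O.comap (algebraMap K (proL ℓ K))) :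
    ∃ ρ : decompSubgroup (F := K) O →*
        GalL ℓ (IsLocalRing.ResidueField (O.comap (algebraMap K (proL ℓ K)))),
      Continuous ρ ∧ Function.Surjective ρ ∧
      ∀ σ, ρ σ = 1 ↔ (σ : GalL ℓ K) ∈ inertiaSubgroup (F := K) O := by
  have hlp : ℓ.Prime := Fact.out
  have hℓk : (ℓ : k) ≠ 0 := CharP.cast_ne_zero_of_ne_of_prime k hlp hpℓ
  have : CharP K p := charP_of_injective_algebraMap (algebraMap k K).injective p
  have hvℓ : O.valuation (ℓ : proL ℓ K) = 1 := by
    have := val_ell O hk ℓ hℓk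
    simpa using this
  have hgal := res_isGalois p O hvℓ
  obtain ⟨ρ, h1, h2, h3⟩ := exists_transfer _ (range_eq_proL p hpℓ O hk) (resAut (F := K) O)
    (resAut_surj O) (fun x => by
      obtain ⟨b, rfl⟩ := IsLocalRing.residue_surjective x
      refine ⟨{σ | σ.1 (b : proL ℓ K) = b}, ?_, ?_⟩
      · have h1 := stabilizer_isOpen_of_isIntegral (K := K) (L := proL ℓ K) (b : proL ℓ K)
        exact (h1.preimage continuous_subtype_val).mem_nhds (by simp)
      · intro σ hσ
        rw [resAut_residue]
        have : decO O σ b = b := Subtype.ext hσ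
        rw [this])
  exact ⟨ρ, h1, h2, fun σ => (h3 σ).trans (resAut_eq_one O σ)⟩

end Ident


theorem prim_pow_eq_iff {E : Type*} [Field E] {ζ : E} {N : ℕ} [NeZero N] (h : IsPrimitiveRoot ζ N)
    (a b : ℕ) : ζ ^ a = ζ ^ b ↔ (a : ZMod N) = b := by
  have hz := h.isUnit (NeZero.ne N)
  obtain ⟨u, rfl⟩ := hz
  have hu : IsPrimitiveRoot u N := IsPrimitiveRoot.coe_units_iff.mp h
  rw [ZMod.natCast_eq_natCast_iff, hu.eq_orderOf, ← pow_eq_pow_iff_modEq]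
  constructor
  · intro h; exact Units.ext (by simpa using h)
  · intro h; simpa using congrArg Units.val h

theorem exists_char (ℓ : ℕ) [Fact ℓ.Prime] {F E : Type*} [Field F] [Field E] [Algebra F E]
    [Algebra.IsIntegral F E] (ζ : ℕ → F) (hζ : ∀ n, IsPrimitiveRoot (ζ n) (ℓ ^ n))
    (hζs : ∀ n, ζ (n + 1) ^ ℓ = ζ n) (π : ℕ → E) (hπs : ∀ n, π (n + 1) ^ ℓ = π n)
    (a : F) (ha : a ≠ 0) (hπ0 : π 0 = algebraMap F E a) :
    ∃ χ : (E ≃ₐ[F] E) →* Multiplicative ℤ_[ℓ], Continuous χ ∧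
      ∀ σ n (m : ℕ), PadicInt.toZModPow n (χ σ).toAdd = (m : ZMod (ℓ ^ n)) ↔
        σ (π n) = algebraMap F E (ζ n) ^ m * π n := by
  have hlp : ℓ.Prime := Fact.out
  have hpow : ∀ n, π n ^ (ℓ ^ n) = algebraMap F E a := by
    intro n
    induction n with
    | zero => simpa using hπ0
    | succ n ih => rw [pow_succ', pow_mul, hπs, ih]
  have ha' : algebraMap F E a ≠ 0 := by simpa using ha
  have hπ : ∀ n, π n ≠ 0 := by
    intro n h
    have := hpow n
    rw [h, zero_pow (pow_ne_zero _ hlp.ne_zero)] at this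
    exact ha' this.symm
  have hζE : ∀ n, IsPrimitiveRoot (algebraMap F E (ζ n)) (ℓ ^ n) := fun n =>
    (hζ n).map_of_injective (algebraMap F E).injective
  have hex : ∀ (σ : E ≃ₐ[F] E) n, ∃ m : ℕ, σ (π n) = algebraMap F E (ζ n) ^ m * π n := by
    intro σ n
    have : NeZero (ℓ ^ n) := ⟨pow_ne_zero _ hlp.ne_zero⟩
    obtain ⟨i, -, hi⟩ := (hζE n).eq_pow_of_pow_eq_one (ξ := σ (π n) / π n) (by
      rw [div_pow, ← map_pow, hpow, AlgEquiv.commutes, div_self ha'])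
    exact ⟨i, by rw [hi, div_mul_cancel₀ _ (hπ n)]⟩
  choose m hm using hex
  have hne : ∀ n, NeZero (ℓ ^ n) := fun n => ⟨pow_ne_zero _ hlp.ne_zero⟩
  have hiff : ∀ σ n (j : ℕ), ((m σ n : ℕ) : ZMod (ℓ ^ n)) = j ↔
      σ (π n) = algebraMap F E (ζ n) ^ j * π n := by
    intro σ n j
    rw [hm, mul_left_inj' (hπ n), prim_pow_eq_iff (hζE n)]
  have hcompat : ∀ σ i, (ℓ : ℤ) ^ i ∣ (m σ (i + 1) : ℤ) - m σ i := by
    intro σ i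
    have h1 := congrArg (· ^ ℓ) (hm σ (i + 1))
    rw [← map_pow, hπs, mul_pow, hπs, ← pow_mul, mul_comm (m σ (i+1)), pow_mul, ← map_pow, hζs] at h1
    have h2 := (hiff σ i _).mpr h1
    have h3 : ((m σ i : ℤ) : ZMod (ℓ ^ i)) = ((m σ (i+1) : ℤ) : ZMod (ℓ ^ i)) := by exact_mod_cast h2
    rw [ZMod.intCast_eq_intCast_iff_dvd_sub] at h3
    exact_mod_cast h3
  let X : (E ≃ₐ[F] E) → ℤ_[ℓ] := fun σ => PadicInt.ofIntSeq _
    (PadicInt.isCauSeq_padicNorm_of_pow_dvd_sub (fun i => (m σ i : ℤ)) ℓ (hcompat σ))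
  have hX : ∀ σ n, PadicInt.toZModPow n (X σ) = (m σ n : ZMod (ℓ ^ n)) := by
    intro σ n
    have := PadicInt.toZModPow_ofIntSeq_of_pow_dvd_sub (fun i => (m σ i : ℤ)) ℓ (hcompat σ) n
    rw [Int.cast_natCast] at this
    exact this
  have hXiff : ∀ σ n (j : ℕ), PadicInt.toZModPow n (X σ) = (j : ZMod (ℓ ^ n)) ↔
      σ (π n) = algebraMap F E (ζ n) ^ j * π n := by
    intro σ n j
    rw [hX, hiff]
  let χ : (E ≃ₐ[F] E) →* Multiplicative ℤ_[ℓ] := MonoidHom.mk' (fun σ => Multiplicative.ofAdd (X σ)) (by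
    intro σ τ
    rw [← ofAdd_add]
    congr 1
    rw [← PadicInt.ext_of_toZModPow]
    intro n
    rw [map_add, hX σ, hX τ, ← Nat.cast_add, hXiff, AlgEquiv.mul_apply, hm τ, map_mul, map_pow,
      AlgEquiv.commutes, hm σ]
    ring)
  refine ⟨χ, ?_, hXiff⟩
  apply continuous_of_continuousAt_one
  have hcont : Filter.Tendsto X (nhds 1) (nhds 0) := by
    rw [Metric.tendsto_nhds]
    intro ε hε
    obtain ⟨n, hn⟩ := PadicInt.exists_pow_neg_lt ℓ hε
    have h1 := stabilizer_isOpen_of_isIntegral (K := F) (L := E) (π n)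
    refine Filter.mem_of_superset (h1.mem_nhds (by simp)) ?_
    intro σ hσ
    change dist (X σ) 0 < ε
    rw [dist_zero_right]
    refine lt_of_le_of_lt ?_ hn
    rw [PadicInt.norm_le_pow_iff_mem_span_pow, ← PadicInt.ker_toZModPow, RingHom.mem_ker]
    have := (hXiff σ n 0).mpr (by
      rw [pow_zero, one_mul]; exact hσ)
    simpa using this
  change Filter.Tendsto χ (nhds 1) (nhds (χ 1))
  rw [map_one]
  exact hcont

theorem exists_zeta (ℓ : ℕ) [Fact ℓ.Prime] (k : Type*) [Field k] [IsAlgClosed k] (hℓ : (ℓ : k) ≠ 0) :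
    ∃ ζ : ℕ → k, (∀ n, IsPrimitiveRoot (ζ n) (ℓ ^ n)) ∧ ∀ n, ζ (n + 1) ^ ℓ = ζ n := by
  have hlp : ℓ.Prime := Fact.out
  have h0 : NeZero (ℓ : k) := ⟨hℓ⟩
  obtain ⟨z, hz⟩ := HasEnoughRootsOfUnity.exists_primitiveRoot k ℓ
  choose r hr using fun x : k => IsAlgClosed.exists_pow_nat_eq x hlp.pos
  let ζ : ℕ → k := fun n => Nat.casesOn n 1 (fun n => r^[n] z)
  have hs : ∀ n, ζ (n + 1) ^ ℓ = ζ n := by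
    intro n
    cases n with
    | zero => exact hz.pow_eq_one
    | succ n =>
      change (r^[n+1] z) ^ ℓ = r^[n] z
      rw [Function.iterate_succ', Function.comp, hr]
  refine ⟨ζ, ?_, hs⟩
  have hp : ∀ n, ζ (n + 1) ^ (ℓ ^ n) = z := by
    intro n
    induction n with
    | zero => simp [ζ]
    | succ n ih => rw [pow_succ', pow_mul, hs, ih]
  intro n
  cases n with
  | zero => rw [pow_zero]; exact (IsPrimitiveRoot.one : IsPrimitiveRoot (1 : k) 1)
  | succ n =>
    rw [IsPrimitiveRoot.iff_orderOf]
    apply orderOf_eq_prime_pow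
    · rw [hp]; exact hz.ne_one hlp.one_lt
    · rw [pow_succ, pow_mul, hp]; exact hz.pow_eq_one

theorem exists_pi {ℓ : ℕ} [Fact ℓ.Prime] {K : Type*} [Field K] (hℓ : (ℓ : K) ≠ 0) {ζ : K}
    (hζ : IsPrimitiveRoot ζ ℓ) (a : K) :
    ∃ π : ℕ → proL ℓ K, π 0 = algebraMap K _ a ∧ ∀ n, π (n + 1) ^ ℓ = π n := by
  have hlp : ℓ.Prime := Fact.out
  have : ∀ x : proL ℓ K, ∃ y : proL ℓ K, y ^ ℓ = x := by
    intro x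
    obtain ⟨z, hz⟩ := IsAlgClosed.exists_pow_nat_eq (x : AlgebraicClosure K) hlp.pos
    exact ⟨⟨z, proL_root hℓ hζ (by rw [hz]; exact x.2)⟩, Subtype.ext hz⟩
  choose r hr using this
  refine ⟨fun n => r^[n] (algebraMap K _ a), rfl, fun n => ?_⟩
  change (r^[n+1] _) ^ ℓ = r^[n] _
  rw [Function.iterate_succ', Function.comp, hr]


section Unif
variable {F E : Type*} [Field F] [Field E] [Algebra F E] (O : ValuationSubring E)

theorem exists_unif (he : Nonempty ((O.comap (algebraMap F E)).ValueGroupˣ ≃* Multiplicative ℤ)) :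
    ∃ a : F, a ≠ 0 ∧ O.valuation (algebraMap F E a) < 1 ∧ ∀ b : F, b ≠ 0 → ∃ j : ℤ,
      O.valuation (algebraMap F E b) = O.valuation (algebraMap F E a) ^ j := by
  obtain ⟨e⟩ := he
  set R := O.comap (algebraMap F E)
  let u := e.symm (Multiplicative.ofAdd 1)
  have hu1 : u ≠ 1 := by
    intro h
    have := congrArg e h
    simp [u] at this
  have hgen : ∀ w : R.ValueGroupˣ, ∃ j : ℤ, w = u ^ j := by
    intro w
    refine ⟨(e w).toAdd, ?_⟩
    apply e.injective
    rw [map_zpow]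
    simp only [u, MulEquiv.apply_symm_apply]
    rw [← ofAdd_zsmul]
    simp
  have : ∃ u' : R.ValueGroupˣ, u' < 1 ∧ ∀ w : R.ValueGroupˣ, ∃ j : ℤ, w = u' ^ j := by
    rcases lt_or_gt_of_ne hu1 with h | h
    · exact ⟨u, h, hgen⟩
    · refine ⟨u⁻¹, inv_lt_one_of_one_lt h, fun w => ?_⟩
      obtain ⟨j, hj⟩ := hgen w
      exact ⟨-j, by simp [hj]⟩
  obtain ⟨u', hu', hgen'⟩ := this
  obtain ⟨a, ha⟩ := R.valuation_surjective (u' : R.ValueGroup)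
  have ha0 : a ≠ 0 := by
    rintro rfl
    rw [map_zero] at ha
    exact u'.ne_zero ha.symm
  refine ⟨a, ha0, ?_, fun b hb => ?_⟩
  · rw [← comap_val_lt, ha]; exact_mod_cast hu'
  · have hb' : R.valuation b ≠ 0 := (Valuation.ne_zero_iff _).mpr hb
    obtain ⟨j, hj⟩ := hgen' (Units.mk0 _ hb')
    refine ⟨j, ?_⟩
    have h1 : R.valuation b = R.valuation a ^ j := by
      have := congrArg Units.val hj
      rw [ha]; simpa using this
    have ha' : R.valuation a ≠ 0 := (Valuation.ne_zero_iff _).mpr ha0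
    have haE : O.valuation (algebraMap F E a) ≠ 0 := (Valuation.ne_zero_iff _).mpr (by simpa using ha0)
    have h2 : R.valuation (b * (a ^ j)⁻¹) = 1 := by
      rw [map_mul, map_inv₀, map_zpow₀, h1, mul_inv_cancel₀ (zpow_ne_zero _ ha')]
    have h3 : O.valuation (algebraMap F E (b * (a ^ j)⁻¹)) = 1 := by
      apply le_antisymm
      · rw [← comap_val_le]; exact h2.le
      · rw [← not_lt, ← comap_val_lt]; exact not_lt.mpr h2.ge
    rw [map_mul, map_mul, map_inv₀, map_inv₀, map_zpow₀, map_zpow₀] at h3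
    exact (mul_inv_eq_one₀ (zpow_ne_zero _ haE)).mp h3

open Polynomial in
theorem exists_eigen_aux (f : E →ₗ[F] E) (s : Finset F) : ∀ x : E, x ≠ 0 →
    aeval f (∏ c ∈ s, (X - C c)) x = 0 → ∃ c ∈ s, ∃ y : E, y ≠ 0 ∧ f y = c • y := by
  classical
  induction s using Finset.induction_on with
  | empty => intro x hx h; simp at h; exact absurd h hx
  | insert c s hc ih =>
    intro x hx h
    by_cases h0 : f x = c • x
    · exact ⟨c, by simp, x, hx, h0⟩
    · rw [Finset.prod_insert hc, mul_comm, map_mul, Module.End.mul_apply] at h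
      have h1 : aeval f (X - C c) x = f x - c • x := by
        simp [Module.algebraMap_end_apply]
      rw [h1] at h
      obtain ⟨d, hd, y, hy⟩ := ih _ (sub_ne_zero.mpr h0) h
      exact ⟨d, by simp [hd], y, hy⟩

open Polynomial in
theorem exists_eigen (σ : E ≃ₐ[F] E) {ζ : F} {N : ℕ} (hN : 0 < N) (hζ : IsPrimitiveRoot ζ N)
    (x : E) (hx : (σ ^ N) x = x) (hne : σ x ≠ x) :
    ∃ c : F, c ^ N = 1 ∧ c ≠ 1 ∧ ∃ y : E, y ≠ 0 ∧ σ y = algebraMap F E c * y := by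
  classical
  let f : E →ₗ[F] E := σ.toLinearMap
  have h1 : (1 : F) ∈ nthRootsFinset N (1 : F) := by
    rw [mem_nthRootsFinset hN]; simp
  have hp := X_pow_sub_one_eq_prod hN hζ
  rw [← Finset.mul_prod_erase _ _ h1, mul_comm] at hp
  have hpow : ∀ m : ℕ, (f ^ m) x = (σ ^ m) x := by
    intro m
    induction m with
    | zero => rfl
    | succ m ih => rw [pow_succ', pow_succ', Module.End.mul_apply, ih]; rfl
  have h2 : aeval f (X ^ N - 1 : F[X]) x = 0 := by
    simp [hpow, hx]
  rw [hp, map_mul, Module.End.mul_apply] at h2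
  have h3 : aeval f (X - C (1 : F)) x = σ x - x := by
    simp [f]
  rw [h3] at h2
  obtain ⟨c, hc, y, hy, hy2⟩ := exists_eigen_aux f _ _ (sub_ne_zero.mpr hne) h2
  rw [Finset.mem_erase, mem_nthRootsFinset hN] at hc
  exact ⟨c, hc.2, hc.1, y, hy, by rw [← Algebra.smul_def]; exact hy2⟩

theorem inert_inj [Algebra.IsAlgebraic F E] (ℓ : ℕ) [Fact ℓ.Prime] (ζ : ℕ → F)
    (hζ : ∀ n, IsPrimitiveRoot (ζ n) (ℓ ^ n))
    (hroot : ∀ (c : F) (n : ℕ), c ^ (ℓ ^ n) = 1 → c ≠ 1 → O.valuation (algebraMap F E (c - 1)) = 1)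
    (π : ℕ → E) (hπs : ∀ n, π (n + 1) ^ ℓ = π n) (hπ0 : π 0 ≠ 0)
    (hval : ∀ b : F, b ≠ 0 → ∃ j : ℤ, O.valuation (algebraMap F E b) = O.valuation (π 0) ^ j)
    (σ : E ≃ₐ[F] E) (hσ : σ ∈ inertiaSubgroup (F := F) O)
    (hfix : ∀ x, ∃ n, (σ ^ (ℓ ^ n)) x = x) (hσπ : ∀ n, σ (π n) = π n) : σ = 1 := by
  have hlp : ℓ.Prime := Fact.out
  have hpow : ∀ n, π n ^ (ℓ ^ n) = π 0 := by
    intro n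
    induction n with
    | zero => simp
    | succ n ih => rw [pow_succ', pow_mul, hπs, ih]
  have hπ : ∀ n, π n ≠ 0 := by
    intro n h
    have := hpow n
    rw [h, zero_pow (pow_ne_zero _ hlp.ne_zero)] at this
    exact hπ0 this.symm
  ext x
  by_contra hne
  obtain ⟨n, hn⟩ := hfix x
  obtain ⟨c, hcN, hc1, y, hy, hσy⟩ := exists_eigen σ (pow_pos hlp.pos n) (hζ n) x hn hne
  obtain ⟨m, hm, a, ha, hma⟩ := exists_pow_val (F := F) O y hy
  obtain ⟨j, hj⟩ := hval a ha
  obtain ⟨s, m', hm', rfl⟩ := Nat.exists_eq_pow_mul_and_not_dvd hm.ne' ℓ hlp.ne_one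
  have hvy : O.valuation y ≠ 0 := (Valuation.ne_zero_iff _).mpr hy
  have hvπ : O.valuation (π s) ≠ 0 := (Valuation.ne_zero_iff _).mpr (hπ s)
  have h1 : (O.valuation y ^ m') ^ (ℓ ^ s) = (O.valuation (π s) ^ j) ^ (ℓ ^ s) := by
    rw [← pow_mul, mul_comm m', hma, hj, ← hpow s, map_pow, ← zpow_natCast, ← zpow_natCast,
      zpow_comm]
  have h2 : O.valuation y ^ m' = O.valuation (π s) ^ j :=
    (pow_left_inj₀ (zero_le') (zero_le') (pow_ne_zero _ hlp.ne_zero)).mp h1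
  set u := y ^ m' * (π s ^ j)⁻¹ with hu
  have hvu : O.valuation u = 1 := by
    rw [hu, map_mul, map_inv₀, map_zpow₀, map_pow, h2, mul_inv_cancel₀ (zpow_ne_zero _ hvπ)]
  have hσu : σ u = algebraMap F E (c ^ m') * u := by
    rw [hu, map_mul, map_inv₀, map_zpow₀, map_pow, hσπ, hσy, map_pow]; ring
  have h3 := hσ.2 u ((O.valuation_le_one_iff u).mp hvu.le)
  have h4 : σ u - u = algebraMap F E (c ^ m' - 1) * u := by
    rw [hσu, map_sub, map_one]; ring
  rw [h4, map_mul, hvu, mul_one] at h3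
  have h5 : c ^ m' = 1 := by
    by_contra h
    rw [hroot (c ^ m') n (by rw [← pow_mul, mul_comm, pow_mul, hcN, one_pow]) h] at h3
    exact lt_irrefl _ h3
  apply hc1
  have hcop : Nat.Coprime (ℓ ^ n) m' := (Nat.Coprime.pow_left _ ((hlp.coprime_iff_not_dvd).mpr hm'))
  have h6 : orderOf c ∣ Nat.gcd (ℓ ^ n) m' := Nat.dvd_gcd (orderOf_dvd_of_pow_eq_one hcN)
    (orderOf_dvd_of_pow_eq_one h5)
  rw [hcop.gcd_eq_one, Nat.dvd_one, orderOf_eq_one_iff] at h6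
  exact h6

end Unif


section Move
variable {F E : Type*} [Field F] [Field E] [Algebra F E] (O : ValuationSubring E)

open Polynomial

theorem zpow_inj_lt {Γ : Type*} [LinearOrderedCommGroupWithZero Γ] {g : Γ} (h0 : g ≠ 0) (h1 : g < 1)
    {i j : ℤ} (h : g ^ i = g ^ j) : i = j :=
  (zpow_right_strictAnti₀ (zero_lt_iff.mpr h0) h1).injective h

theorem term_inj {ℓ : ℕ} {g : O.ValueGroup} (hg0 : g ≠ 0) (hg1 : g < 1)
    (hval : ∀ b : F, b ≠ 0 → ∃ j : ℤ, O.valuation (algebraMap F E b) = g ^ (ℓ * j)) {b c : F} (hb : b ≠ 0) (hc : c ≠ 0) {i j : ℕ} (hi : i < ℓ) (hj : j < ℓ)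
    (h : O.valuation (algebraMap F E b) * g ^ i = O.valuation (algebraMap F E c) * g ^ j) : i = j := by
  obtain ⟨s, hs⟩ := hval b hb
  obtain ⟨t, ht⟩ := hval c hc
  rw [hs, ht, ← zpow_natCast, ← zpow_natCast, ← zpow_add₀ hg0, ← zpow_add₀ hg0] at h
  have h2 := zpow_inj_lt hg0 hg1 h
  have h3 := congrArg (· % (ℓ : ℤ)) h2
  simp only [Int.mul_add_emod_self_left] at h3
  rw [Int.emod_eq_of_lt (by omega) (by omega), Int.emod_eq_of_lt (by omega) (by omega)] at h3
  exact_mod_cast h3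

theorem val_poly {ℓ : ℕ} {g : O.ValueGroup} (hg0 : g ≠ 0) (hg1 : g < 1)
    (hval : ∀ b : F, b ≠ 0 → ∃ j : ℤ, O.valuation (algebraMap F E b) = g ^ (ℓ * j)) (q : F[X]) (hq0 : q ≠ 0) (hq : q.natDegree < ℓ) :
    ∃ i ∈ q.support, ∀ w : E, O.valuation w = g →
      O.valuation (aeval w q) = O.valuation (algebraMap F E (q.coeff i)) * g ^ i ∧
      ∀ j ∈ q.support, O.valuation (algebraMap F E (q.coeff j)) * g ^ j ≤
        O.valuation (algebraMap F E (q.coeff i)) * g ^ i := by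
  classical
  obtain ⟨i, his, hi⟩ := q.support.exists_max_image
    (fun i => O.valuation (algebraMap F E (q.coeff i)) * g ^ i) (nonempty_support_iff.mpr hq0)
  refine ⟨i, his, fun w hw => ⟨?_, hi⟩⟩
  have hlt : ∀ j ∈ q.support, j < ℓ := fun j hj => (le_natDegree_of_mem_supp j hj).trans_lt hq
  rw [aeval_eq_sum_range' hq]
  have hterm : ∀ j, O.valuation (q.coeff j • w ^ j) = O.valuation (algebraMap F E (q.coeff j)) * g ^ j := by
    intro j
    rw [Algebra.smul_def, map_mul, map_pow, hw]
  rw [Valuation.map_sum_eq_of_lt (j := i) _ (Finset.mem_range.mpr (hlt i his)), hterm]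
  intro j hj
  rw [Finset.mem_sdiff, Finset.mem_singleton, Finset.mem_range] at hj
  rw [hterm, hterm]
  by_cases hjs : j ∈ q.support
  · refine lt_of_le_of_ne (hi j hjs) ?_
    intro h
    exact hj.2 (term_inj O hg0 hg1 hval (mem_support_iff.mp hjs) (mem_support_iff.mp his) hj.1 (hlt i his) h)
  · rw [notMem_support_iff.mp hjs, map_zero, Valuation.map_zero, zero_mul, zero_lt_iff]
    refine mul_ne_zero ?_ (pow_ne_zero _ hg0)
    rw [Valuation.ne_zero_iff, _root_.map_ne_zero]
    exact mem_support_iff.mp his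

theorem val_poly_eq {ℓ : ℕ} {g : O.ValueGroup} (hg0 : g ≠ 0) (hg1 : g < 1)
    (hval : ∀ b : F, b ≠ 0 → ∃ j : ℤ, O.valuation (algebraMap F E b) = g ^ (ℓ * j)) (q : F[X]) (hq : q.natDegree < ℓ) {w w' : E} (hw : O.valuation w = g)
    (hw' : O.valuation w' = g) : O.valuation (aeval w q) = O.valuation (aeval w' q) := by
  by_cases hq0 : q = 0
  · simp [hq0]
  obtain ⟨i, -, h⟩ := val_poly O hg0 hg1 hval q hq0 hq
  rw [(h w hw).1, (h w' hw').1]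

theorem val_poly_res {ℓ : ℕ} (hℓ : ℓ ≠ 0) {g : O.ValueGroup} (hg0 : g ≠ 0) (hg1 : g < 1)
    (hval : ∀ b : F, b ≠ 0 → ∃ j : ℤ, O.valuation (algebraMap F E b) = g ^ (ℓ * j)) (q : F[X]) (hq : q.natDegree < ℓ) {w : E} (hw : O.valuation w = g)
    (h1 : O.valuation (aeval w q) ≤ 1) : O.valuation (algebraMap F E (q.coeff 0)) ≤ 1 ∧
    O.valuation (aeval w q - algebraMap F E (q.coeff 0)) < 1 := by
  by_cases hq0 : q = 0
  · simp [hq0]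
  obtain ⟨i, his, h⟩ := val_poly O hg0 hg1 hval q hq0 hq
  obtain ⟨h2, h3⟩ := h w hw
  have h4 : ∀ j, O.valuation (algebraMap F E (q.coeff j)) * g ^ j ≤ 1 := by
    intro j
    by_cases hj : j ∈ q.support
    · exact (h3 j hj).trans (h2 ▸ h1)
    · rw [notMem_support_iff.mp hj]; simp
  refine ⟨by simpa using h4 0, ?_⟩
  obtain ⟨n, rfl⟩ := Nat.exists_eq_succ_of_ne_zero hℓ
  rw [aeval_eq_sum_range' hq, Finset.sum_range_succ', pow_zero, Algebra.smul_def _ (1 : E), mul_one,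
    add_sub_cancel_right]
  apply Valuation.map_sum_lt _ one_ne_zero
  intro j hj
  rw [Finset.mem_range] at hj
  rw [Algebra.smul_def, map_mul, map_pow, hw]
  refine lt_of_le_of_ne (h4 _) fun h5 => ?_
  have hc : q.coeff (j + 1) ≠ 0 := by
    intro h; rw [h] at h5; simp at h5
  have := term_inj O hg0 hg1 hval (c := 1) hc one_ne_zero (i := j + 1) (j := 0) (by omega) (by omega)
    (by simpa using h5)
  omega

theorem mem_adjoin_rep {ℓ : ℕ} {a : F} {w : E} (hw : w ^ ℓ = algebraMap F E a) (hℓ : ℓ ≠ 0) {x : E}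
    (hx : x ∈ F⟮w⟯) : ∃ q : F[X], q.natDegree < ℓ ∧ x = aeval w q := by
  have hm : (X ^ ℓ - C a : F[X]).Monic := monic_X_pow_sub_C a hℓ
  have hint : IsIntegral F w := ⟨X ^ ℓ - C a, hm, by simp [hw]⟩
  rw [← IntermediateField.mem_toSubalgebra, adjoin_simple_toSubalgebra_of_isAlgebraic hint.isAlgebraic] at hx
  rw [Algebra.adjoin_singleton_eq_range_aeval] at hx
  obtain ⟨p, rfl⟩ := hx
  refine ⟨p %ₘ (X ^ ℓ - C a), ?_, ?_⟩
  · have := natDegree_modByMonic_lt p hm (by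
      intro h
      have := congrArg natDegree h
      rw [natDegree_X_pow_sub_C] at this
      simp at this; exact hℓ this)
    rwa [natDegree_X_pow_sub_C] at this
  · rw [aeval_modByMonic_eq_self_of_root]
    · rfl
    · simp [hw]

theorem exists_move {ℓ : ℕ} {g : O.ValueGroup} (hg0 : g ≠ 0) (hg1 : g < 1)
    (hval : ∀ b : F, b ≠ 0 → ∃ j : ℤ, O.valuation (algebraMap F E b) = g ^ (ℓ * j)) [IsGalois F E] (hℓp : 1 < ℓ) {a : F} {w : E} (hw : w ^ ℓ = algebraMap F E a)
    (hwg : O.valuation w = g) :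
    ∃ τ ∈ inertiaSubgroup (F := F) O, τ w ≠ w := by
  have hℓ : ℓ ≠ 0 := by omega
  have hw0 : w ≠ 0 := by rintro rfl; rw [map_zero] at hwg; exact hg0 hwg.symm
  -- w not in F
  have hwF : w ∉ (⊥ : IntermediateField F E) := by
    rintro ⟨b, hb⟩
    have hb0 : b ≠ 0 := by rintro rfl; rw [map_zero] at hb; exact hw0 hb.symm
    obtain ⟨j, hj⟩ := hval b hb0
    change algebraMap F E b = w at hb
    rw [hb, hwg] at hj
    have := zpow_inj_lt hg0 hg1 (i := 1) (j := ℓ * j) (by rw [zpow_one]; exact hj)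
    have h2 : (ℓ : ℤ) ∣ 1 := ⟨j, this⟩
    have h3 := Int.le_of_dvd one_pos h2
    omega
  rw [InfiniteGalois.mem_bot_iff_fixed] at hwF
  push Not at hwF
  obtain ⟨σ, hσ⟩ := hwF
  have hσw : (σ w) ^ ℓ = algebraMap F E a := by rw [← map_pow, hw, AlgEquiv.commutes]
  have hσg : O.valuation (σ w) = g := by
    have : O.valuation (σ w) ^ ℓ = g ^ ℓ := by rw [← hwg, ← Valuation.map_pow, hσw, ← Valuation.map_pow, hw]
    exact (pow_left_inj₀ zero_le' zero_le' hℓ).mp this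
  let K1 := F⟮w⟯
  let O2 : ValuationSubring E := O.comap (σ : E →+* E)
  have hcomap : O.comap (algebraMap K1 E) = O2.comap (algebraMap K1 E) := by
    ext x
    rw [ValuationSubring.mem_comap, ValuationSubring.mem_comap, ValuationSubring.mem_comap]
    obtain ⟨q, hq, hx⟩ := mem_adjoin_rep hw hℓ x.2
    change (x : E) ∈ O ↔ σ (x : E) ∈ O
    have h9 : σ (aeval w q) = aeval (σ w) q := (Polynomial.aeval_algHom_apply σ w q).symm
    rw [hx, h9, ← O.valuation_le_one_iff, ← O.valuation_le_one_iff,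
      val_poly_eq O hg0 hg1 hval q hq hwg hσg]
  obtain ⟨γ, hγ⟩ := val_trans hcomap
  let s : E ≃ₐ[F] E := σ * γ.restrictScalars F
  have hs : s ∈ decompSubgroup (F := F) O := fun x => hγ x
  have hγw : γ w = w := γ.commutes ⟨w, mem_adjoin_simple_self F w⟩
  have hsw : s w = σ w := congrArg σ hγw
  obtain ⟨γ', hγ'1, hγ'2⟩ := val_surj (F := K1) O (resAut (F := F) O ⟨s, hs⟩).toRingEquiv (by
    intro r hr
    obtain ⟨q, hq, hx⟩ := mem_adjoin_rep hw hℓ r.2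
    have hx' : algebraMap K1 E r = aeval w q := hx
    have hr1 := (O.valuation_le_one_iff _).mpr hr
    rw [hx'] at hr1
    obtain ⟨h1, h2⟩ := val_poly_res O hℓ hg0 hg1 hval q hq hwg hr1
    have h3 : IsLocalRing.residue O ⟨_, hr⟩ =
        IsLocalRing.residue O ⟨_, (O.valuation_le_one_iff _).mp h1⟩ := by
      rw [residue_eq_iff]
      change O.valuation (algebraMap K1 E r - _) < 1
      rw [hx']; exact h2
    rw [h3]
    change resAut (F := F) O ⟨s, hs⟩ _ = _
    rw [resAut_residue]
    congr 1
    exact Subtype.ext (s.commutes _))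
  have hγ'w : γ' w = w := γ'.commutes ⟨w, mem_adjoin_simple_self F w⟩
  let t : E ≃ₐ[F] E := γ'.restrictScalars F
  have ht : t ∈ decompSubgroup (F := F) O := fun x => hγ'1 x
  have hres : resAut (F := F) O ⟨t, ht⟩ = resAut (F := F) O ⟨s, hs⟩ := by
    ext y
    obtain ⟨r, rfl⟩ := IsLocalRing.residue_surjective y
    exact hγ'2 r
  refine ⟨t⁻¹ * s, ?_, ?_⟩
  · have : resAut (F := F) O (⟨t, ht⟩⁻¹ * ⟨s, hs⟩) = 1 := by
      rw [map_mul, map_inv, hres, inv_mul_cancel]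
    exact (resAut_eq_one O _).mp this
  · intro h
    apply hσ
    rw [← hsw]
    have h2 := congrArg t h
    rw [AlgEquiv.mul_apply] at h2
    have h3 : t (t⁻¹ (s w)) = s w := t.apply_symm_apply _
    rw [h3] at h2
    rw [h2]; exact hγ'w

end Move


section Top
variable {F E : Type*} [Field F] [Field E] [Algebra F E] [IsGalois F E] (O : ValuationSubring E)

theorem isOpen_eval (x : E) (S : Set E) : IsOpen {σ : E ≃ₐ[F] E | σ x ∈ S} := by
  rw [isOpen_iff_mem_nhds]
  intro σ hσ
  have h1 := stabilizer_isOpen_of_isIntegral (K := F) (L := E) x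
  have h2 : IsOpen ((fun τ : E ≃ₐ[F] E => σ⁻¹ * τ) ⁻¹' (MulAction.stabilizer (E ≃ₐ[F] E) x : Set _)) :=
    h1.preimage (continuous_const_mul _)
  refine Filter.mem_of_superset (h2.mem_nhds (by simp)) ?_
  intro τ hτ
  have h3 : σ⁻¹ (τ x) = x := hτ
  have h4 := congrArg σ h3
  have h5 : σ (σ⁻¹ (τ x)) = τ x := σ.apply_symm_apply _
  rw [h5] at h4
  change τ x ∈ S
  rw [h4]; exact hσ

theorem isClosed_eval (x : E) (S : Set E) : IsClosed {σ : E ≃ₐ[F] E | σ x ∈ S} := by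
  rw [← isOpen_compl_iff]
  exact isOpen_eval x Sᶜ

theorem decomp_closed : IsClosed (decompSubgroup (F := F) O : Set (E ≃ₐ[F] E)) := by
  have : (decompSubgroup (F := F) O : Set (E ≃ₐ[F] E)) =
      ⋂ x : E, {σ : E ≃ₐ[F] E | σ x ∈ {y | y ∈ O ↔ x ∈ O}} := by
    ext σ; rw [Set.mem_iInter]; exact Iff.rfl
  rw [this]
  exact isClosed_iInter fun x => isClosed_eval x _

theorem inertia_closed : IsClosed (inertiaSubgroup (F := F) O : Set (E ≃ₐ[F] E)) := by
  have : (inertiaSubgroup (F := F) O : Set (E ≃ₐ[F] E)) =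
      (⋂ x : E, {σ : E ≃ₐ[F] E | σ x ∈ {y | y ∈ O ↔ x ∈ O}}) ∩
      ⋂ x : E, {σ : E ≃ₐ[F] E | σ x ∈ {y | x ∈ O → O.valuation (y - x) < 1}} := by
    ext σ; simp [inertiaSubgroup]
  rw [this]
  exact (isClosed_iInter fun x => isClosed_eval x _).inter (isClosed_iInter fun x => isClosed_eval x _)

end Top

theorem char_surj {ℓ : ℕ} [Fact ℓ.Prime] (H : Subgroup (Multiplicative ℤ_[ℓ]))
    (hH : IsClosed (H : Set (Multiplicative ℤ_[ℓ]))) (c : Multiplicative ℤ_[ℓ]) (hc : c ∈ H)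
    (hc1 : PadicInt.toZModPow 1 c.toAdd ≠ 0) (z : Multiplicative ℤ_[ℓ]) : z ∈ H := by
  have hu : IsUnit c.toAdd := by
    rw [← not_not (a := IsUnit _)]
    intro h
    apply hc1
    have : c.toAdd ∈ IsLocalRing.maximalIdeal ℤ_[ℓ] := h
    rw [PadicInt.maximalIdeal_eq_span_p] at this
    rw [← RingHom.mem_ker, PadicInt.ker_toZModPow, pow_one]
    exact this
  obtain ⟨u, hu⟩ := hu
  have hcl : IsClosed {y : ℤ_[ℓ] | Multiplicative.ofAdd (y * c.toAdd) ∈ H} :=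
    hH.preimage (continuous_ofAdd.comp (continuous_mul_const c.toAdd))
  have hall : ∀ y : ℤ_[ℓ], Multiplicative.ofAdd (y * c.toAdd) ∈ H := by
    intro y
    refine PadicInt.denseRange_natCast.induction_on (p := fun y => Multiplicative.ofAdd (y * c.toAdd) ∈ H) y hcl ?_
    intro n
    have := pow_mem hc n
    rwa [← nsmul_eq_mul, ofAdd_nsmul, ofAdd_toAdd]
  have := hall (z.toAdd * (u⁻¹ : ℤ_[ℓ]ˣ))
  rw [← hu, mul_assoc, Units.inv_mul, mul_one] at this
  exact this

theorem inertia_char {ℓ : ℕ} [Fact ℓ.Prime] {k K : Type*} [Field k] [Field K] [Algebra k K]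
    [IsAlgClosed k] (p : ℕ) [Fact p.Prime] [CharP k p] (hpℓ : p ≠ ℓ)
    (O : ValuationSubring (proL ℓ K))
    (hk : ∀ c : k, algebraMap k K c ∈ O.comap (algebraMap K (proL ℓ K)))
    (he : Nonempty ((O.comap (algebraMap K (proL ℓ K))).ValueGroupˣ ≃* Multiplicative ℤ)) :
    ∃ χ : GalL ℓ K →* Multiplicative ℤ_[ℓ], Continuous χ ∧
      (∀ σ ∈ inertiaSubgroup (F := K) O, χ σ = 1 → σ = 1) ∧
      ∀ z, ∃ σ ∈ inertiaSubgroup (F := K) O, χ σ = z := by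
  have hlp : ℓ.Prime := Fact.out
  have hℓk : (ℓ : k) ≠ 0 := CharP.cast_ne_zero_of_ne_of_prime k hlp hpℓ
  have hℓK : (ℓ : K) ≠ 0 := by
    rw [← map_natCast (algebraMap k K)]; rw [map_ne_zero]; exact hℓk
  obtain ⟨ζ0, hζ0, hζ0s⟩ := exists_zeta ℓ k hℓk
  let ζ : ℕ → K := fun n => algebraMap k K (ζ0 n)
  have hζ : ∀ n, IsPrimitiveRoot (ζ n) (ℓ ^ n) := fun n =>
    (hζ0 n).map_of_injective (algebraMap k K).injective
  have hζs : ∀ n, ζ (n + 1) ^ ℓ = ζ n := fun n => by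
    simp only [ζ]; rw [← map_pow, hζ0s]
  have hζ1 : IsPrimitiveRoot (ζ 1) ℓ := by simpa using hζ 1
  obtain ⟨a, ha0, ha1, hval⟩ := exists_unif O he
  obtain ⟨π, hπ0, hπs⟩ := exists_pi hℓK hζ1 a
  have hint : Algebra.IsIntegral K (proL ℓ K) := inferInstance
  obtain ⟨χ, hχc, hχ⟩ := exists_char ℓ ζ hζ hζs π hπs a ha0 hπ0
  have hπ0' : π 0 ≠ 0 := by rw [hπ0, map_ne_zero]; exact ha0
  have hroot : ∀ (c : K) (n : ℕ), c ^ (ℓ ^ n) = 1 → c ≠ 1 →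
      O.valuation (algebraMap K _ (c - 1)) = 1 := by
    intro c n hcn hc1
    have : NeZero (ℓ ^ n) := ⟨pow_ne_zero _ hlp.ne_zero⟩
    obtain ⟨i, -, hi⟩ := (hζ n).eq_pow_of_pow_eq_one hcn
    have h1 : c - 1 = algebraMap k K (ζ0 n ^ i - 1) := by
      rw [← hi, map_sub, map_pow, map_one]
    rw [h1]
    apply val_ell O hk
    intro h0
    rw [h0, map_zero] at h1
    exact hc1 (sub_eq_zero.mp h1)
  refine ⟨χ, hχc, ?_, ?_⟩
  · intro σ hσ h1
    refine inert_inj O ℓ ζ hζ hroot π hπs hπ0' (by rw [hπ0]; exact hval) σ hσ ?_ ?_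
    · intro x
      obtain ⟨n, hn⟩ := galL_pow_fix ℓ K x
      exact ⟨n, hn σ⟩
    · intro n
      have := (hχ σ n 0).mp (by rw [h1]; simp)
      simpa using this
  · have hg0 : O.valuation (π 1) ≠ 0 := by
      rw [Valuation.ne_zero_iff]
      intro h
      apply hπ0'
      rw [← hπs 0, zero_add, h, zero_pow hlp.ne_zero]
    have hva : O.valuation (algebraMap K _ a) = O.valuation (π 1) ^ ℓ := by
      rw [← hπ0, ← hπs 0, map_pow]
    have hg1 : O.valuation (π 1) < 1 := by
      rw [hva] at ha1
      exact (pow_lt_one_iff hlp.ne_zero).mp ha1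
    obtain ⟨τ, hτ, hτπ⟩ := exists_move (F := K) O hg0 hg1 (ℓ := ℓ) (by
      intro b hb
      obtain ⟨j, hj⟩ := hval b hb
      exact ⟨j, by rw [hj, hva, zpow_mul, zpow_natCast]⟩) hlp.one_lt (a := a) (by
        rw [← hπ0, ← hπs 0]) rfl
    let H : Subgroup (Multiplicative ℤ_[ℓ]) := (inertiaSubgroup (F := K) O).map χ
    have hHc : IsClosed (H : Set (Multiplicative ℤ_[ℓ])) := by
      have h1 : IsCompact (inertiaSubgroup (F := K) O : Set (GalL ℓ K)) :=
        (inertia_closed O).isCompact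
      exact (h1.image hχc).isClosed
    intro z
    obtain ⟨σ, hσ, h⟩ := char_surj H hHc (χ τ) ⟨τ, hτ, rfl⟩ (by
      intro h
      apply hτπ
      have := (hχ τ 1 0).mp (by rw [h]; simp)
      simpa using this) z
    exact ⟨σ, hσ, h⟩


section LemB
open scoped IntermediateField.algebraAdjoinAdjoin
open Polynomial

theorem linIndep_of_poly {L K : Type*} [Field L] [Field K] [Algebra L K] (π : K)
    {ι : Type*} [Fintype ι] (b : ι → K)
    (h : ∀ f : ι → L[X], ∑ i, aeval π (f i) * b i = 0 → ∀ i, aeval π (f i) = 0) :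
    LinearIndependent L⟮π⟯ b := by
  rw [← LinearIndependent.iff_fractionRing (R := Algebra.adjoin L {π}) (K := L⟮π⟯)]
  rw [Fintype.linearIndependent_iff]
  intro g hg
  have h1 : ∀ i, ∃ f : L[X], aeval π f = (g i : K) := by
    intro i
    have h0 : ∀ z : K, z ∈ Algebra.adjoin L {π} → ∃ f : L[X], aeval π f = z := by
      intro z hz
      rw [Algebra.adjoin_singleton_eq_range_aeval] at hz
      exact hz
    exact h0 _ (g i).2
  choose f hf using h1
  have h2 := h f (by
    simp_rw [hf]
    exact hg)
  intro i
  have := h2 i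
  rw [hf] at this
  exact Subtype.ext this

theorem val_linIndep {L K : Type*} [Field L] [Field K] [Algebra L K] (R : ValuationSubring K)
    (h : ∀ c : L, algebraMap L K c ∈ R) (π : K) (hπ0 : π ≠ 0) (hπ : R.valuation π < 1)
    {ι : Type*} [Fintype ι] (b : ι → R)
    (hb : ∀ c : ι → L, ∑ i, resMap R h (c i) * IsLocalRing.residue R (b i) = 0 → ∀ i, c i = 0) :
    LinearIndependent L⟮π⟯ (fun i => (b i : K)) := by
  have hπR : π ∈ R := (R.valuation_le_one_iff π).1 hπ.le
  let π' : R := ⟨π, hπR⟩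
  let φ : L →+* R := (algebraMap L K).codRestrict R.toSubring h
  have hres : IsLocalRing.residue R π' = 0 := by
    have := (residue_eq_iff R π' 0).2 (by simpa [π'] using hπ)
    simpa using this
  have key : ∀ n : ℕ, ∀ f : ι → L[X], ∑ i, eval₂ φ π' (f i) * b i = 0 → ∀ i, X ^ n ∣ f i := by
    intro n
    induction n with
    | zero => intro f _ i; simp
    | succ n ih =>
      intro f hf
      have h0 : ∀ i, (f i).coeff 0 = 0 := by
        apply hb (fun i => (f i).coeff 0)
        have := congrArg (IsLocalRing.residue R) hf
        rw [map_sum, map_zero] at this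
        rw [← this]
        refine Finset.sum_congr rfl fun i _ => ?_
        rw [map_mul, hom_eval₂, hres, eval₂_at_zero]
        rfl
      have h1 : ∀ i, f i = X * divX (f i) := by
        intro i
        have := X_mul_divX_add (f i)
        rw [h0, C_0, add_zero] at this
        exact this.symm
      have h2 := ih (fun i => divX (f i)) (by
        have h3 : π' * ∑ i, eval₂ φ π' (divX (f i)) * b i = 0 := by
          rw [Finset.mul_sum, ← hf]
          refine Finset.sum_congr rfl fun i _ => ?_
          conv_rhs => rw [h1 i]
          rw [eval₂_mul, eval₂_X, mul_assoc]
        rcases mul_eq_zero.1 h3 with h4 | h4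
        · exact absurd (congrArg Subtype.val h4) hπ0
        · exact h4)
      intro i
      rw [h1 i, pow_succ']
      exact mul_dvd_mul_left _ (h2 i)
  apply linIndep_of_poly
  intro f hf i
  have h5 : ∑ i, eval₂ φ π' (f i) * b i = 0 := by
    apply Subtype.ext
    have : R.subtype (∑ i, eval₂ φ π' (f i) * b i) = 0 := by
      rw [map_sum, ← hf]
      refine Finset.sum_congr rfl fun i _ => ?_
      rw [map_mul, hom_eval₂]
      rfl
    exact this
  have h6 := key ((f i).natDegree + 1) f h5 i
  have h7 : f i = 0 := by
    by_contra hne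
    have := natDegree_le_of_dvd h6 hne
    rw [natDegree_X_pow] at this
    omega
  rw [h7, map_zero]

theorem res_finite {L K : Type*} [Field L] [Field K] [Algebra L K] (R : ValuationSubring K)
    (h : ∀ c : L, algebraMap L K c ∈ R) (π : K) (hπ0 : π ≠ 0) (hπ : R.valuation π < 1)
    [FiniteDimensional L⟮π⟯ K] :
    letI := (resMap R h).toAlgebra
    Module.Finite L (IsLocalRing.ResidueField R) := by
  letI := (resMap R h).toAlgebra
  rw [← Module.rank_lt_aleph0_iff]
  refine lt_of_le_of_lt (rank_le (n := Module.finrank L⟮π⟯ K) ?_) (Cardinal.natCast_lt_aleph0)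
  intro s hs
  have hl : ∀ i : s, ∃ r : R, IsLocalRing.residue R r = i := fun i =>
    IsLocalRing.residue_surjective _
  choose b hb using hl
  have := val_linIndep R h π hπ0 hπ b (by
    intro c hc
    rw [Fintype.linearIndependent_iff] at hs
    apply hs c
    rw [← hc]
    refine Finset.sum_congr rfl fun i _ => ?_
    rw [Algebra.smul_def, hb]
    rfl)
  simpa using this.fintype_card_le_finrank

end LemB

theorem findim_of_trdeg {k K : Type*} [Field k] [Field K] [Algebra k K] [Algebra.EssFiniteType k K]
    {s : Set K} (hs : AlgebraicIndependent k ((↑) : s → K)) (L : IntermediateField k K)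
    (hsL : s ⊆ L) (htd : Algebra.trdeg k K ≤ Cardinal.mk s + 1) (π : K)
    (hπ : Transcendental L π) : FiniteDimensional L⟮π⟯ K := by
  have hfin := trdeg_lt_aleph0 k K
  have h1 : AlgebraicIndependent k (fun i : s => (⟨i, hsL i.2⟩ : L)) :=
    AlgebraicIndependent.of_comp L.val hs
  have h2 : Cardinal.mk s ≤ Algebra.trdeg k L := h1.cardinalMk_le_trdeg
  have h3 := trdeg_add_eq k L (A := K)
  have h4 : Algebra.trdeg L K ≤ 1 := by
    have hL : Algebra.trdeg k L < Cardinal.aleph0 := lt_of_le_of_lt (by rw [← h3]; exact self_le_add_right _ _) hfin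
    have hLK : Algebra.trdeg L K < Cardinal.aleph0 := lt_of_le_of_lt (by rw [← h3]; exact self_le_add_left _ _) hfin
    have hss := lt_of_le_of_lt h2 hL
    obtain ⟨a, ha⟩ := Cardinal.lt_aleph0.1 hL
    obtain ⟨b, hb⟩ := Cardinal.lt_aleph0.1 hLK
    obtain ⟨c, hc⟩ := Cardinal.lt_aleph0.1 hss
    rw [← h3] at htd
    rw [ha, hb, hc] at htd
    rw [ha, hc] at h2
    rw [hb]
    norm_cast at *
    omega
  have h5 : AlgebraicIndependent L (fun _ : PUnit => π) :=
    algebraicIndependent_unique_type_iff.2 hπ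
  have h6 : IsTranscendenceBasis L (fun _ : PUnit => π) :=
    h5.isTranscendenceBasis_of_trdeg_le_of_finite (by simpa using h4)
  have h7 := h6.isAlgebraic_field
  rw [Set.range_const] at h7
  haveI := h7
  haveI : Algebra.EssFiniteType L⟮π⟯ K := by
    haveI : Algebra.EssFiniteType L K := Algebra.EssFiniteType.of_comp k L K
    exact Algebra.EssFiniteType.of_comp L L⟮π⟯ K
  exact Algebra.finite_of_essFiniteType_of_isAlgebraic

theorem mem_of_algebraic {L K : Type*} [Field L] [Field K] [Algebra L K] (R : ValuationSubring K)
    (h : ∀ c : L, algebraMap L K c ∈ R) (y : K) (hy : IsAlgebraic L y) : y ∈ R := by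
  have h1 : IsIntegral L y := hy.isIntegral
  have : IsIntegral R y := by
    obtain ⟨p, hp, hpx⟩ := h1
    let f : L →+* R := (algebraMap L K).codRestrict R.toSubring h
    refine ⟨p.map f, hp.map f, ?_⟩
    rw [Polynomial.eval₂_map]
    exact hpx
  obtain ⟨z, hz⟩ := (IsIntegrallyClosed.isIntegral_iff (R := R) (K := K)).1 this
  rw [← hz]; exact z.2

theorem res_essFinite {k K : Type*} [Field k] [Field K] [Algebra k K] [Algebra.EssFiniteType k K]
    (R : ValuationSubring K) (h : ∀ c : k, algebraMap k K c ∈ R) (π : K) (hπ0 : π ≠ 0)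
    (hπ : R.valuation π < 1)
    (htd : letI := (resMap R h).toAlgebra
      Algebra.trdeg k K ≤ Algebra.trdeg k (IsLocalRing.ResidueField R) + 1) :
    letI := (resMap R h).toAlgebra
    Algebra.EssFiniteType k (IsLocalRing.ResidueField R) := by
  letI a1 : Algebra k (IsLocalRing.ResidueField R) := (resMap R h).toAlgebra
  letI a2 : Algebra k R := ((algebraMap k K).codRestrict R.toSubring h).toAlgebra
  let f : R →ₐ[k] IsLocalRing.ResidueField R :=
    { IsLocalRing.residue R with commutes' := fun _ => rfl }
  let g : R →ₐ[k] K := { R.subtype with commutes' := fun _ => rfl }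
  have hg : Function.Injective g := Subtype.val_injective
  obtain ⟨s, hs⟩ := exists_isTranscendenceBasis k (IsLocalRing.ResidueField R)
  have hl : ∀ i : s, ∃ r : R, f r = i := fun i => IsLocalRing.residue_surjective _
  choose t ht using hl
  have hft : f ∘ t = Subtype.val := funext ht
  have htR : AlgebraicIndependent k t := AlgebraicIndependent.of_comp f (by rw [hft]; exact hs.1)
  have htK : AlgebraicIndependent k (g ∘ t) := htR.map' hg
  have hcard : Cardinal.mk (Set.range (g ∘ t)) = Cardinal.mk s :=
    Cardinal.mk_range_eq _ htK.injective
  have hs2 := hs.cardinalMk_eq_trdeg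
  let L : IntermediateField k K := IntermediateField.adjoin k (Set.range (g ∘ t))
  have hLR : ∀ c : L, algebraMap L K c ∈ R := by
    rintro ⟨x, hx⟩
    change x ∈ R
    obtain ⟨r, q, rfl⟩ := (IntermediateField.mem_adjoin_range_iff _ _ _).1 hx
    by_cases hq : q = 0
    · subst hq; simp
    have h1 : ∀ r : MvPolynomial s k, MvPolynomial.aeval (g ∘ t) r = g (MvPolynomial.aeval t r) := by
      intro r
      rw [← AlgHom.comp_apply, MvPolynomial.comp_aeval]; rfl
    have h2 : f (MvPolynomial.aeval t q) ≠ 0 := by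
      rw [← AlgHom.comp_apply, MvPolynomial.comp_aeval]
      change MvPolynomial.aeval (f ∘ t) q ≠ 0
      rw [hft]
      intro h3
      exact hq (hs.1.eq_zero_of_aeval_eq_zero _ h3)
    have h3 : IsUnit (MvPolynomial.aeval t q) := by
      by_contra hu
      exact h2 ((IsLocalRing.residue_eq_zero_iff _).2 ((IsLocalRing.mem_maximalIdeal _).2 hu))
    obtain ⟨w, hw⟩ := h3.exists_left_inv
    have h4 : g w = (g (MvPolynomial.aeval t q))⁻¹ := by
      refine eq_inv_of_mul_eq_one_left ?_
      rw [← map_mul, hw, map_one]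
    rw [h1, h1, div_eq_mul_inv, ← h4, ← map_mul]
    exact (MvPolynomial.aeval t r * w).2
  have hπL : Transcendental L π := by
    intro halg
    have h1 := mem_of_algebraic R hLR π⁻¹ halg.inv
    rcases (val_lt_one_iff' R π).1 hπ with h2 | h2
    · exact hπ0 h2
    · exact h2 h1
  haveI : FiniteDimensional L⟮π⟯ K := findim_of_trdeg htK.to_subtype_range L
    (IntermediateField.subset_adjoin _ _) (by rw [hcard, hs2]; exact htd) π hπL
  letI a3 : Algebra L (IsLocalRing.ResidueField R) := (resMap R hLR).toAlgebra
  haveI : Module.Finite L (IsLocalRing.ResidueField R) := res_finite R hLR π hπ0 hπ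
  haveI : IsScalarTower k L (IsLocalRing.ResidueField R) :=
    IsScalarTower.of_algebraMap_eq (fun _ => rfl)
  have hfin : Finite s := by
    have h1 := Cardinal.lt_aleph0_iff_finite.1 (lt_of_le_of_lt htK.cardinalMk_le_trdeg (trdeg_lt_aleph0 k K))
    exact h1
  haveI : Algebra.EssFiniteType k L := IntermediateField.essFiniteType_iff.2
    (IntermediateField.fg_adjoin_of_finite (Set.finite_range _))
  exact Algebra.EssFiniteType.comp k L (IsLocalRing.ResidueField R)


section Div
open scoped IntermediateField.algebraAdjoinAdjoin
open Polynomial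

theorem alg_mem {k E : Type*} [Field k] [IsAlgClosed k] [Field E] [Algebra k E] (w : E)
    (hw : IsAlgebraic k w) : ∃ c : k, algebraMap k E c = w :=
  minpoly.mem_range_of_degree_eq_one k w
    (IsAlgClosed.degree_eq_one_of_irreducible k (minpoly.irreducible hw.isIntegral))

theorem linIndep_pow {L F : Type*} [Field L] [Field F] [Algebra L F] (x y : F) (N : ℕ) (hN : 0 < N)
    (hx : Transcendental L x) (hy : y ^ N = x) :
    LinearIndependent L⟮x⟯ (fun i : Fin N => y ^ (i : ℕ)) := by
  apply linIndep_of_poly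
  intro f hf i
  have hyt : Transcendental L y := by
    intro h; exact hx (hy ▸ h.pow N)
  have h1 : aeval y (∑ j : Fin N, expand L N (f j) * X ^ (j : ℕ)) = 0 := by
    rw [map_sum, ← hf]
    refine Finset.sum_congr rfl fun j _ => ?_
    rw [map_mul, expand_aeval, hy, map_pow, aeval_X]
  have h2 : ∑ j : Fin N, expand L N (f j) * X ^ (j : ℕ) = 0 := by
    by_contra hne
    exact hyt ⟨_, hne, h1⟩
  have h3 : f i = 0 := by
    ext m
    have h4 := congrArg (fun P => coeff P (N * m + i)) h2
    simp only [finset_sum_coeff, coeff_zero] at h4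
    rw [Finset.sum_eq_single i] at h4
    · rw [coeff_mul_X_pow, mul_comm, coeff_expand_mul hN] at h4
      simpa using h4
    · intro j _ hj
      rw [coeff_mul_X_pow', coeff_expand hN]
      split_ifs with ha hb
      · exfalso
        apply hj
        have hi := i.2
        have hj2 := j.2
        obtain ⟨c, hc⟩ := hb
        have h6 : N * m + (i : ℕ) = N * c + j := by omega
        have h7 := congrArg (· % N) h6
        simp only [Nat.mul_add_mod, Nat.mod_eq_of_lt hi, Nat.mod_eq_of_lt hj2] at h7
        exact Fin.ext h7.symm
      · rfl
      · rfl
    · intro h; exact absurd (Finset.mem_univ _) h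
  rw [h3, map_zero]

theorem divisible_mem {k F : Type*} [Field k] [IsAlgClosed k] [Field F] [Algebra k F]
    [Algebra.EssFiniteType k F] (ℓ : ℕ) (hℓ : 1 < ℓ) (x : F) (h : ∀ n : ℕ, ∃ y : F, y ^ (ℓ ^ n) = x) :
    ∃ c : k, algebraMap k F c = x := by
  by_contra hx
  have hxt : Transcendental k x := fun h => hx (alg_mem x h)
  have h0 : AlgebraicIndepOn k id ({x} : Set F) :=
    algebraicIndependent_unique_type_iff.2 hxt
  obtain ⟨t, hxt', ht⟩ := exists_isTranscendenceBasis_superset h0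
  have hxm : x ∈ t := hxt' rfl
  have hins : insert x (t \ {x}) = t := Set.insert_sdiff_self_of_mem hxm
  have h1 : AlgebraicIndepOn k id (insert x (t \ {x})) := by rw [hins]; exact ht.1
  rw [AlgebraicIndepOn.insert_iff (by simp)] at h1
  obtain ⟨h2, h3⟩ := h1
  rw [Set.image_id] at h3
  have h4 : Transcendental (IntermediateField.adjoin k (t \ {x})) x := by
    intro h5
    exact h3 ((IsFractionRing.isAlgebraic_iff (Algebra.adjoin k (t \ {x}))
      (IntermediateField.adjoin k (t \ {x})) F).2 h5)
  have htd : Algebra.trdeg k F ≤ Cardinal.mk (t \ {x} : Set F) + 1 := by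
    rw [← ht.cardinalMk_eq_trdeg]
    conv_lhs => rw [← hins]
    exact Cardinal.mk_insert_le
  haveI := findim_of_trdeg (k := k) h2 (IntermediateField.adjoin k (t \ {x}))
    (IntermediateField.subset_adjoin _ _) htd x h4
  obtain ⟨n, hn⟩ : ∃ n, Module.finrank (IntermediateField.adjoin k (t \ {x}))⟮x⟯ F < ℓ ^ n :=
    ⟨_, Nat.lt_pow_self hℓ⟩
  obtain ⟨y, hy⟩ := h n
  have := (linIndep_pow x y (ℓ ^ n) (by positivity) h4 hy).fintype_card_le_finrank
  simp at this
  omega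
end Div

theorem no_abelian {k F E : Type*} [Field k] [IsAlgClosed k] [Field F] [Field E] [Algebra k F]
    [Algebra F E] [Algebra k E] [IsScalarTower k F E] [Algebra.EssFiniteType k F] [IsGalois F E]
    (ℓ : ℕ) (hℓ : 1 < ℓ) (hroot : ∀ x : E, ∃ y : E, y ^ ℓ = x)
    (hpow : ∀ (σ : E ≃ₐ[F] E) (x : E), ∃ n : ℕ, (σ ^ (ℓ ^ n)) x = x)
    (A : Subgroup (E ≃ₐ[F] E)) (hab : ∀ a ∈ A, ∀ b ∈ A, a * b = b * a)
    (hnorm : ∀ z : E ≃ₐ[F] E, ∀ a ∈ A, z * a * z⁻¹ ∈ A) (σ : E ≃ₐ[F] E) (hσ : σ ∈ A) : σ = 1 := by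
  have hk : ∀ (τ : E ≃ₐ[F] E) (c : k), τ (algebraMap k E c) = algebraMap k E c := by
    intro τ c
    rw [IsScalarTower.algebraMap_apply k F E]
    exact τ.commutes _
  have hroots : ∀ (n : ℕ) (x : E), ∃ y : E, y ^ (ℓ ^ n) = x := by
    intro n
    induction n with
    | zero => intro x; exact ⟨x, by simp⟩
    | succ n ih =>
      intro x
      obtain ⟨y, hy⟩ := hroot x
      obtain ⟨w, hw⟩ := ih y
      exact ⟨w, by rw [pow_succ, pow_mul, hw, hy]⟩
  have hmu : ∀ (N : ℕ), 0 < N → ∀ w : E, w ^ N = 1 → ∃ c : k, algebraMap k E c = w := by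
    intro N hN w hw
    apply alg_mem
    apply IsAlgebraic.of_pow hN
    rw [hw]; exact isAlgebraic_one
  -- step 1
  have step1 : ∀ x : E, x ≠ 0 → ∃ u : k, σ (σ x) * x = algebraMap k E u * (σ x) ^ 2 := by
    intro x hx
    have hσx : σ x ≠ 0 := (_root_.map_ne_zero σ).2 hx
    haveI : FiniteDimensional F F⟮x⟯ :=
      IntermediateField.adjoin.finiteDimensional (Algebra.IsIntegral.isIntegral x)
    let F' : IntermediateField F E := IntermediateField.normalClosure F F⟮x⟯ E
    haveI : Normal F F' := inferInstance
    haveI : FiniteDimensional F F' := inferInstance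
    have hxF : x ∈ F' := (IntermediateField.le_normalClosure F⟮x⟯) (IntermediateField.mem_adjoin_simple_self F x)
    have hstab : ∀ (τ : E ≃ₐ[F] E) (w : E), w ∈ F' → τ w ∈ F' := by
      intro τ w hw
      have := AlgEquiv.restrictNormal_commutes τ F' ⟨w, hw⟩
      change _ = τ w at this
      rw [← this]; exact Subtype.property _
    let q : E := σ (σ x) * x / (σ x) ^ 2
    have hq : q ∈ F' := F'.div_mem (F'.mul_mem (hstab _ _ (hstab _ _ hxF)) hxF) (_root_.pow_mem (hstab _ _ hxF) 2)
    haveI : Algebra.EssFiniteType k F' := Algebra.EssFiniteType.comp k F F'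
    obtain ⟨c, hc⟩ := divisible_mem (k := k) ℓ hℓ (⟨q, hq⟩ : F') (by
      intro n
      obtain ⟨y, hy⟩ := hroots n x
      have hN : 0 < ℓ ^ n := by positivity
      have hy0 : y ≠ 0 := by
        rintro rfl
        rw [zero_pow hN.ne'] at hy
        exact hx hy.symm
      have hσy : σ y ≠ 0 := (_root_.map_ne_zero σ).2 hy0
      have hσσy : σ (σ y) ≠ 0 := (_root_.map_ne_zero σ).2 hσy
      have hz : σ (σ y) * y / (σ y) ^ 2 ∈ F' := by
        rw [← InfiniteGalois.fixedField_fixingSubgroup F']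
        rintro ⟨τ, hτ⟩
        change τ (σ (σ y) * y / (σ y) ^ 2) = σ (σ y) * y / (σ y) ^ 2
        have hτ' : ∀ w ∈ F', τ w = w := fun w hw => hτ ⟨w, hw⟩
        have hz : ∀ v : E, v ≠ 0 → v ^ (ℓ ^ n) ∈ F' → ∃ c : k, τ v = algebraMap k E c * v := by
          intro v hv hvF
          obtain ⟨c, hc⟩ := hmu (ℓ ^ n) hN (τ v / v) (by
            rw [div_pow, ← map_pow, hτ' _ hvF, div_self (pow_ne_zero _ hv)])
          exact ⟨c, by rw [hc, div_mul_cancel₀ _ hv]⟩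
        obtain ⟨c1, h1⟩ := hz y hy0 (by rw [hy]; exact hxF)
        obtain ⟨c2, h2⟩ := hz (σ y) hσy (by rw [← map_pow, hy]; exact hstab _ _ hxF)
        obtain ⟨c3, h3⟩ := hz (σ (σ y)) hσσy (by
          rw [← map_pow, ← map_pow, hy]; exact hstab _ _ (hstab _ _ hxF))
        have hc2 : algebraMap k E c2 ≠ 0 := by
          intro h0
          rw [h0, zero_mul] at h2
          exact hσy ((map_eq_zero τ).1 h2)
        have hc3 : algebraMap k E c3 ≠ 0 := by
          intro h0
          rw [h0, zero_mul] at h3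
          exact hσσy ((map_eq_zero τ).1 h3)
        let b : E ≃ₐ[F] E := τ⁻¹ * σ * τ
        have hb : b ∈ A := by
          have := hnorm τ⁻¹ σ hσ
          rwa [inv_inv] at this
        have hτb : ∀ v, τ (b v) = σ (τ v) := fun v => τ.apply_symm_apply _
        have hcom : b (σ y) = σ (b y) := by
          have := congrArg (fun g : E ≃ₐ[F] E => g y) (hab b hb σ hσ)
          exact this
        have e1 : b y * algebraMap k E c2 = algebraMap k E c1 * σ y := by
          apply τ.injective
          rw [map_mul, hτb, h1, map_mul, map_mul, hk, hk, hk, h2]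
          ring
        have e2 : b (σ y) * algebraMap k E c3 = algebraMap k E c2 * σ (σ y) := by
          apply τ.injective
          rw [map_mul, hτb, h2, map_mul, map_mul, hk, hk, hk, h3]
          ring
        have e3 : b (σ y) * algebraMap k E c2 = algebraMap k E c1 * σ (σ y) := by
          rw [hcom]
          have := congrArg σ e1
          rwa [map_mul, map_mul, hk, hk] at this
        have e4 : algebraMap k E c3 * algebraMap k E c1 = algebraMap k E c2 ^ 2 := by
          apply mul_right_cancel₀ hσσy
          linear_combination (algebraMap k E c2) * e2 - (algebraMap k E c3) * e3
        rw [map_div₀, map_mul, map_pow, h1, h2, h3, mul_pow, ← e4]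
        have hc1 : algebraMap k E c1 ≠ 0 := by
          intro h0
          rw [h0, mul_zero] at e4
          exact pow_ne_zero 2 hc2 e4.symm
        field_simp
      refine ⟨⟨_, hz⟩, Subtype.ext ?_⟩
      change (σ (σ y) * y / (σ y) ^ 2) ^ (ℓ ^ n) = σ (σ x) * x / (σ x) ^ 2
      rw [← hy, div_pow, mul_pow, map_pow, map_pow, ← pow_mul, ← pow_mul, mul_comm 2])
    refine ⟨c, ?_⟩
    have hc' : algebraMap k E c = q := congrArg Subtype.val hc
    rw [hc']
    exact (div_mul_cancel₀ _ (pow_ne_zero 2 hσx)).symm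
  have step2 : ∀ x : E, x ≠ 0 → ∃ c : k, σ x = algebraMap k E c * x := by
    intro x hx
    have hσx : σ x ≠ 0 := (_root_.map_ne_zero σ).2 hx
    obtain ⟨u, hu⟩ := step1 x hx
    have hu0 : algebraMap k E u ≠ 0 := by
      intro h0
      rw [h0, zero_mul] at hu
      rcases mul_eq_zero.1 hu with h | h
      · exact hσx ((map_eq_zero σ).1 h)
      · exact hx h
    let β := σ x / x
    have hβ0 : β ≠ 0 := div_ne_zero hσx hx
    have hβx : σ x = β * x := (div_mul_cancel₀ _ hx).symm
    have hβ : σ β = algebraMap k E u * β := by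
      change σ (σ x / x) = _ * (σ x / x)
      rw [map_div₀, div_eq_iff hσx, mul_div_assoc', div_mul_eq_mul_div, eq_div_iff hx, hu]
      ring
    have hj : ∀ j : ℕ, ∃ c : k, c ≠ 0 ∧ (σ ^ j) x = algebraMap k E c * β ^ j * x := by
      intro j
      induction j with
      | zero => exact ⟨1, one_ne_zero, by simp⟩
      | succ j ih =>
        obtain ⟨c, hc0, hc⟩ := ih
        refine ⟨c * u ^ j, mul_ne_zero hc0 (pow_ne_zero _ (fun h => hu0 (by rw [h, map_zero]))), ?_⟩
        rw [pow_succ', AlgEquiv.mul_apply, hc, map_mul, map_mul, hk, map_pow, hβ, hβx, map_mul, map_pow]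
        ring
    obtain ⟨n, hn⟩ := hpow σ x
    obtain ⟨c, hc0, hc⟩ := hj (ℓ ^ n)
    rw [hn] at hc
    have hc1 : algebraMap k E c * β ^ (ℓ ^ n) = 1 := by
      apply mul_right_cancel₀ hx
      rw [← hc, one_mul]
    have hβa : IsAlgebraic k β := by
      apply IsAlgebraic.of_pow (n := ℓ ^ n) (by positivity)
      rw [eq_inv_of_mul_eq_one_right hc1, ← map_inv₀]
      exact isAlgebraic_algebraMap _
    obtain ⟨d, hd⟩ := alg_mem β hβa
    exact ⟨d, by rw [hd]; exact hβx⟩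
  apply AlgEquiv.ext
  intro x
  change σ x = x
  by_cases hxk : ∃ c : k, algebraMap k E c = x
  · obtain ⟨c, rfl⟩ := hxk
    exact hk σ c
  have hx0 : x ≠ 0 := fun h => hxk ⟨0, by rw [h, map_zero]⟩
  have hx1 : x + 1 ≠ 0 := fun h => hxk ⟨-1, by rw [map_neg, map_one]; linear_combination -h⟩
  obtain ⟨c, hc⟩ := step2 x hx0
  obtain ⟨d, hd⟩ := step2 (x + 1) hx1
  rw [map_add, map_one, hc] at hd
  by_cases hcd : c = d
  · subst hcd
    have : algebraMap k E c = 1 := by linear_combination -hd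
    rw [hc, this, one_mul]
  · exfalso
    apply hxk
    refine ⟨(d - 1) / (c - d), ?_⟩
    have h1 : algebraMap k E (c - d) ≠ 0 := (_root_.map_ne_zero _).2 (sub_ne_zero.2 hcd)
    rw [map_div₀, div_eq_iff h1, map_sub, map_sub, map_one]
    linear_combination -hd


theorem no_abelian_galL (ℓ : ℕ) [Fact ℓ.Prime] {k F : Type*} [Field k] [IsAlgClosed k] [Field F]
    [Algebra k F] [Algebra.EssFiniteType k F] (hℓ : (ℓ : k) ≠ 0)
    (A : Subgroup (GalL ℓ F)) (hab : ∀ a ∈ A, ∀ b ∈ A, a * b = b * a)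
    (hnorm : ∀ z : GalL ℓ F, ∀ a ∈ A, z * a * z⁻¹ ∈ A) (σ : GalL ℓ F) (hσ : σ ∈ A) : σ = 1 := by
  have hlp : ℓ.Prime := Fact.out
  letI : Algebra k (proL ℓ F) := ((algebraMap F (proL ℓ F)).comp (algebraMap k F)).toAlgebra
  haveI : IsScalarTower k F (proL ℓ F) := IsScalarTower.of_algebraMap_eq (fun _ => rfl)
  refine no_abelian (k := k) ℓ hlp.one_lt ?_ ?_ A hab hnorm σ hσ
  · intro x
    obtain ⟨ζ, hζ, -⟩ := exists_zeta ℓ k hℓ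
    have hζ1 : IsPrimitiveRoot (algebraMap k F (ζ 1)) ℓ := by
      have := (hζ 1).map_of_injective (algebraMap k F).injective
      rwa [pow_one] at this
    have hℓF : (ℓ : F) ≠ 0 := by
      rw [← map_natCast (algebraMap k F)]
      exact (_root_.map_ne_zero _).2 hℓ
    obtain ⟨y, hy⟩ := IsAlgClosed.exists_pow_nat_eq (x : AlgebraicClosure F) hlp.pos
    exact ⟨⟨y, proL_root hℓF hζ1 (by rw [hy]; exact x.2)⟩, Subtype.ext hy⟩
  · intro τ x
    obtain ⟨n, hn⟩ := galL_pow_fix ℓ F x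
    exact ⟨n, hn τ⟩

theorem assemble {G H X : Type*} [Group G] [TopologicalSpace G] [CompactSpace G]
    [Group H] [TopologicalSpace H] [T2Space H] [Group X] [TopologicalSpace X] [T2Space X]
    (hX : ∀ a b : X, a * b = b * a)
    (Z T : Subgroup G) (hZ : IsClosed (Z : Set G)) (hT : IsClosed (T : Set G)) (hTZ : T ≤ Z)
    (χ : G →* X) (hχ : Continuous χ) (hinj : ∀ σ ∈ T, χ σ = 1 → σ = 1)
    (hsurj : ∀ z, ∃ σ ∈ T, χ σ = z)
    (ρ : Z →* H) (hρ : Continuous ρ) (hρs : Function.Surjective ρ)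
    (hρT : ∀ σ, ρ σ = 1 ↔ (σ : G) ∈ T)
    (hH : ∀ A : Subgroup H, (∀ a ∈ A, ∀ b ∈ A, a * b = b * a) →
      (∀ z : H, ∀ a ∈ A, z * a * z⁻¹ ∈ A) → ∀ a ∈ A, a = 1) :
    ((∃ e : T ≃* X, Continuous e ∧ Continuous e.symm) ∧ (∀ σ ∈ Z, ∀ τ ∈ T, σ * τ * σ⁻¹ = τ)) ∧
    ((IsClosed (T : Set G) ∧ T ≤ Z ∧ (∀ a ∈ T, ∀ b ∈ T, a * b = b * a) ∧
      (∀ z ∈ Z, ∀ t ∈ T, z * t * z⁻¹ ∈ T)) ∧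
      ∀ T' : Subgroup G, IsClosed (T' : Set G) → T' ≤ Z → (∀ a ∈ T', ∀ b ∈ T', a * b = b * a) →
        (∀ z ∈ Z, ∀ t ∈ T', z * t * z⁻¹ ∈ T') → T' ≤ T) ∧
    (∃ e : Z ≃* (X × H), Continuous e ∧ Continuous e.symm ∧
      ∀ σ : Z, (σ : G) ∈ T ↔ (e σ).2 = 1) := by
  haveI : CompactSpace Z := isCompact_iff_compactSpace.1 hZ.isCompact
  haveI : CompactSpace T := isCompact_iff_compactSpace.1 hT.isCompact
  have hTinj : ∀ σ ∈ T, ∀ τ ∈ T, χ σ = χ τ → σ = τ := by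
    intro σ hσ τ hτ h
    have := hinj (σ * τ⁻¹) (T.mul_mem hσ (T.inv_mem hτ)) (by rw [map_mul, map_inv, h, mul_inv_cancel])
    exact mul_inv_eq_one.1 this
  have hnorm : ∀ z ∈ Z, ∀ t ∈ T, z * t * z⁻¹ ∈ T := by
    intro z hz t ht
    have h1 := (hρT ⟨t, hTZ ht⟩).2 ht
    have h2 := (hρT (⟨z, hz⟩ * ⟨t, hTZ ht⟩ * ⟨z, hz⟩⁻¹)).1 (by
      rw [map_mul, map_mul, h1, mul_one, map_inv, mul_inv_cancel])
    exact h2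
  have hconj : ∀ σ ∈ Z, ∀ τ ∈ T, σ * τ * σ⁻¹ = τ := by
    intro σ hσ τ hτ
    apply hTinj _ (hnorm σ hσ τ hτ) _ hτ
    rw [map_mul, map_mul, hX (χ σ), mul_assoc, map_inv, mul_inv_cancel, mul_one]
  have hΦi : Function.Injective ((χ.comp Z.subtype).prod ρ) := by
    rw [injective_iff_map_eq_one]
    intro σ hσ
    have h1 : χ σ = 1 := congrArg Prod.fst hσ
    have h2 : ρ σ = 1 := congrArg Prod.snd hσ
    exact Subtype.ext (hinj _ ((hρT σ).1 h2) h1)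
  have hΦs : Function.Surjective ((χ.comp Z.subtype).prod ρ) := by
    rintro ⟨x, h⟩
    obtain ⟨σ, hσ⟩ := hρs h
    obtain ⟨τ, hτ, hτx⟩ := hsurj (x * (χ σ)⁻¹)
    refine ⟨⟨τ, hTZ hτ⟩ * σ, ?_⟩
    apply Prod.ext
    · change χ (τ * σ) = x
      rw [map_mul, hτx, inv_mul_cancel_right]
    · change ρ (⟨τ, hTZ hτ⟩ * σ) = h
      rw [map_mul, (hρT ⟨τ, hTZ hτ⟩).2 hτ, one_mul, hσ]
  have hΦc : Continuous ((χ.comp Z.subtype).prod ρ) :=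
    (hχ.comp continuous_subtype_val).prodMk hρ
  refine ⟨⟨?_, hconj⟩, ⟨⟨hT, hTZ, ?_, hnorm⟩, ?_⟩, ?_⟩
  · let e : T ≃* X := MulEquiv.ofBijective (χ.comp T.subtype)
      ⟨fun a b h => Subtype.ext (hTinj a a.2 b b.2 h), fun z => by
        obtain ⟨σ, hσ, h⟩ := hsurj z
        exact ⟨⟨σ, hσ⟩, h⟩⟩
    have he : Continuous e := hχ.comp continuous_subtype_val
    exact ⟨e, he, Continuous.continuous_symm_of_equiv_compact_to_t2 (f := e.toEquiv) he⟩
  · intro a ha b hb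
    have := hconj a (hTZ ha) b hb
    rw [mul_inv_eq_iff_eq_mul] at this
    exact this
  · intro T' _ hT'Z hab hn t ht
    have h1 := hH ((T'.subgroupOf Z).map ρ) (by
      rintro _ ⟨a, ha, rfl⟩ _ ⟨b, hb, rfl⟩
      rw [← map_mul, ← map_mul]
      congr 1
      exact Subtype.ext (hab a ha b hb)) (by
      rintro z _ ⟨a, ha, rfl⟩
      obtain ⟨w, rfl⟩ := hρs z
      refine ⟨w * a * w⁻¹, ?_, by simp⟩
      exact hn w w.2 a ha) (ρ ⟨t, hT'Z ht⟩) ⟨⟨t, hT'Z ht⟩, ht, rfl⟩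
    exact (hρT _).1 h1
  · let e : Z ≃* (X × H) := MulEquiv.ofBijective _ ⟨hΦi, hΦs⟩
    have he : Continuous e := hΦc
    exact ⟨e, he, Continuous.continuous_symm_of_equiv_compact_to_t2 (f := e.toEquiv) he,
      fun σ => (hρT σ).symm⟩

/-- For a Zariski prime divisor `v` of `K|k` with prolongation to `K^ℓ` of
valuation ring `O'`: the inertia group `T_v` is isomorphic to `ℤ_ℓ` as a topological group,
conjugation of `Z_v` on `T_v` is trivial, `T_v` is the unique maximal closed abelian normal
subgroup of `Z_v`, and `Z_v ≅ ℤ_ℓ × G^ℓ_{Kv}` as topological groups, compatibly with `T_v`. -/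
theorem statement3 (ℓ p : ℕ) [Fact ℓ.Prime] [Fact p.Prime] (hpℓ : p ≠ ℓ)
    (k K : Type*) [Field k] [Field K] [Algebra k K]
    [IsAlgClosed k] [CharP k p] (hkfin : Algebra.IsAlgebraic (⊥ : Subfield k) k)
    (hKfg : (⊤ : IntermediateField k K).FG) (htd : 1 < trdeg k K)
    (O' : ValuationSubring ↥(proL ℓ K))
    (hzpd : IsZPD k (O'.comap (algebraMap K ↥(proL ℓ K)))) :
    -- (a) `T_v ≅ ℤ_ℓ` topologically, and the conjugation action of `Z_v` on `T_v` is trivial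
    ((∃ e : ↥(inertiaSubgroup (F := K) O') ≃* Multiplicative ℤ_[ℓ],
        Continuous e ∧ Continuous e.symm) ∧
      (∀ σ ∈ decompSubgroup (F := K) O', ∀ τ ∈ inertiaSubgroup (F := K) O',
        σ * τ * σ⁻¹ = τ)) ∧
    -- (b) `T_v` is the unique maximal closed abelian normal subgroup of `Z_v`
    ((IsClosed ((inertiaSubgroup (F := K) O' : Subgroup (GalL ℓ K)) : Set (GalL ℓ K)) ∧
        inertiaSubgroup (F := K) O' ≤ decompSubgroup (F := K) O' ∧
        (∀ a ∈ inertiaSubgroup (F := K) O', ∀ b ∈ inertiaSubgroup (F := K) O',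
          a * b = b * a) ∧
        (∀ z ∈ decompSubgroup (F := K) O', ∀ t ∈ inertiaSubgroup (F := K) O',
          z * t * z⁻¹ ∈ inertiaSubgroup (F := K) O')) ∧
      ∀ T : Subgroup (GalL ℓ K), IsClosed ((T : Subgroup (GalL ℓ K)) : Set (GalL ℓ K)) →
        T ≤ decompSubgroup (F := K) O' → (∀ a ∈ T, ∀ b ∈ T, a * b = b * a) →
        (∀ z ∈ decompSubgroup (F := K) O', ∀ t ∈ T, z * t * z⁻¹ ∈ T) →
        T ≤ inertiaSubgroup (F := K) O') ∧
    -- (c) the canonical exact sequence `1 → T_v → Z_v → G^ℓ_{Kv} → 1` splits: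
    -- `Z_v ≅ ℤ_ℓ × G^ℓ_{Kv}` as topological groups, carrying `T_v` onto the first factor
    (∃ e : ↥(decompSubgroup (F := K) O') ≃*
        (Multiplicative ℤ_[ℓ] ×
          GalL ℓ (IsLocalRing.ResidueField ↥(O'.comap (algebraMap K ↥(proL ℓ K))))),
      Continuous e ∧ Continuous e.symm ∧
      ∀ σ : ↥(decompSubgroup (F := K) O'),
        (σ : GalL ℓ K) ∈ inertiaSubgroup (F := K) O' ↔ (e σ).2 = 1) := by
  have hlp : ℓ.Prime := Fact.out
  have hℓk : (ℓ : k) ≠ 0 := CharP.cast_ne_zero_of_ne_of_prime k hlp hpℓ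
  have hk := hzpd.trivialBase
  have he := hzpd.discrete
  obtain ⟨χ, hχ, hinj, hsurj⟩ := inertia_char (k := k) p hpℓ O' hk he
  obtain ⟨ρ, hρ, hρs, hρT⟩ := exists_res (k := k) p hpℓ O' hk
  obtain ⟨π, hπ0, hπ, -⟩ := exists_unif O' he
  haveI : Algebra.EssFiniteType k K := IntermediateField.fg_top_iff.1 hKfg
  letI := (resMap (O'.comap (algebraMap K ↥(proL ℓ K))) hk).toAlgebra
  haveI := res_essFinite (O'.comap (algebraMap K ↥(proL ℓ K))) hk π hπ0
    ((comap_val_lt O' π).2 hπ) (le_of_eq hzpd.residue_td.symm)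
  exact assemble mul_comm _ _ (decomp_closed O') (inertia_closed O') (fun σ h => h.1) χ hχ hinj hsurj
    ρ hρ hρs hρT (fun A h1 h2 => no_abelian_galL ℓ hℓk A h1 h2)
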